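/- Let α ≥ 4 be real and b > 1/2. There exists C > 0 (depending only on α and b) such that for all nonnegative f, f₁, f₂ ∈ L²(ℝ³), the integral over the set of (ξ₁, μ₁, τ₁, ξ, μ, τ) ∈ ℝ⁶ with ξ ξ₁ ξ₂ ≠ 0 (ξ₂ := ξ − ξ₁, μ₂ := μ − μ₁, τ₂ := τ − τ₁) and resonance hypothesis |σ − σ₁ − σ₂| ≥ |Δ|/α, of W · f(ξ, μ, τ) f₁(ξ₁, μ₁, τ₁) f₂(ξ₂, μ₂, τ₂), is at most C ‖f‖_{L²} ‖f₁‖_{L²} ‖f₂‖_{L²}, for each of the four weights W: (i) W = |ξ₁|^{-1/2}|ξ₂|^{α/4} ⟨σ₁⟩^{-b}⟨σ₂⟩^{-b}; (ii) W = |ξ₁|^{-1/2}|ξ|^{α/4} ⟨σ₁⟩^{-b}⟨σ⟩^{-b}; (iii) W = |ξ|^{-1/2}|ξ₂|^{α/4} ⟨σ⟩^{-b}⟨σ₂⟩^{-b}; (iv) W = |ξ|^{-1/2}|ξ₁|^{α/4} ⟨σ⟩^{-b}⟨σ₁⟩^{-b}. (Paper's Lemma 2.5, inequalities (2.017)–(2.020).)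 -/

import Mathlib

open MeasureTheory

/-- The generalized KP-I dispersion relation `φ(ξ, μ) = ξ|ξ|^α + μ²/ξ`. -/
noncomputable def phi (α ξ μ : ℝ) : ℝ := ξ * |ξ| ^ α + μ ^ 2 / ξ

/-- The modulation `σ = τ + φ(ξ, μ)` of a point `p = (ξ, μ, τ)`. -/
noncomputable def sigma (α : ℝ) (p : ℝ × ℝ × ℝ) : ℝ := p.2.2 + phi α p.1 p.2.1

/-- Componentwise difference of two frequency-space points. -/
def sub3 (q p : ℝ × ℝ × ℝ) : ℝ × ℝ × ℝ := (q.1 - p.1, q.2.1 - p.2.1, q.2.2 - p.2.2)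

/-- `Δ = ξ|ξ|^α − ξ₁|ξ₁|^α − ξ₂|ξ₂|^α` with `ξ₂ = ξ − ξ₁`. -/
noncomputable def res (α ξ ξ₁ : ℝ) : ℝ :=
  ξ * |ξ| ^ α - ξ₁ * |ξ₁| ^ α - (ξ - ξ₁) * |ξ - ξ₁| ^ α

/-- The weight `|x|^{-1/2} |y|^{α/4} ⟨s⟩^{-b} ⟨t⟩^{-b}` of Lemma 2.5. -/
noncomputable def wgt (α b x y s t : ℝ) : ℝ :=
  |x| ^ (-(1 : ℝ) / 2) * |y| ^ (α / 4) * (1 + |s|) ^ (-b) * (1 + |t|) ^ (-b)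

open scoped ENNReal

section ChangeOfVariables

theorem setLIntegral_abs_deriv_mul_comp_le {s : Set ℝ} (hs : MeasurableSet s) {f f' : ℝ → ℝ}
    (hf : ∀ x ∈ s, HasDerivAt f (f' x) x) (hinj : Set.InjOn f s) (g : ℝ → ℝ≥0∞) :
    ∫⁻ x in s, ENNReal.ofReal |f' x| * g (f x) ≤ ∫⁻ y, g y := by
  rw [← lintegral_image_eq_lintegral_abs_deriv_mul hs
    (fun x hx => (hf x hx).hasDerivWithinAt) hinj]
  exact setLIntegral_le_lintegral _ _

theorem injOn_of_hasDerivAt_ne_zero {s : Set ℝ} (hs : s.OrdConnected) {f f' : ℝ → ℝ}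
    (hf : ∀ x ∈ s, HasDerivAt f (f' x) x) (hf' : ∀ x ∈ s, f' x ≠ 0) : Set.InjOn f s := by
  have key : ∀ x ∈ s, ∀ y ∈ s, x < y → f x ≠ f y := by
    intro x hx y hy hxy h
    have hsub := hs.out hx hy
    obtain ⟨c, hc, h0⟩ := exists_hasDerivAt_eq_zero hxy
      (fun z hz => (hf z (hsub hz)).continuousAt.continuousWithinAt) h
      (fun z hz => hf z (hsub (Set.Ioo_subset_Icc_self hz)))
    exact hf' c (hsub (Set.Ioo_subset_Icc_self hc)) h0
  intro x hx y hy h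
  rcases lt_trichotomy x y with hlt | heq | hgt
  · exact absurd h (key x hx y hy hlt)
  · exact heq
  · exact absurd h.symm (key y hy x hx hgt)

/-- Level sets of a quadratic form: in the cone where the form is comparable to `|z|²`, composing
with the form costs only a constant. -/
theorem lintegral_comp_quadratic_le {G : ℝ → ℝ≥0∞} (hG : Measurable G) (c e₁ e₂ : ℝ) {K : ℝ}
    (hK : 0 < K) :
    ∫⁻ z : ℝ × ℝ, {z : ℝ × ℝ | z.1 ^ 2 + z.2 ^ 2 ≤ K * |e₁ * z.1 ^ 2 + e₂ * z.2 ^ 2|}.indicator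
      (fun z => G (c + e₁ * z.1 ^ 2 + e₂ * z.2 ^ 2)) z ≤
      ENNReal.ofReal (Real.pi * K) * ∫⁻ t, G t := by
  rw [← lintegral_comp_polarCoord_symm]
  have htar : polarCoord.target = Set.Ioi (0 : ℝ) ×ˢ Set.Ioo (-Real.pi) Real.pi := rfl
  have hmS : MeasurableSet
      {z : ℝ × ℝ | z.1 ^ 2 + z.2 ^ 2 ≤ K * |e₁ * z.1 ^ 2 + e₂ * z.2 ^ 2|} :=
    measurableSet_le (by fun_prop) (by fun_prop)
  have hm : Measurable (fun z : ℝ × ℝ =>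
      {z : ℝ × ℝ | z.1 ^ 2 + z.2 ^ 2 ≤ K * |e₁ * z.1 ^ 2 + e₂ * z.2 ^ 2|}.indicator
      (fun z => G (c + e₁ * z.1 ^ 2 + e₂ * z.2 ^ 2)) z) :=
    (by fun_prop : Measurable fun z : ℝ × ℝ =>
      G (c + e₁ * z.1 ^ 2 + e₂ * z.2 ^ 2)).indicator hmS
  have hm' : Measurable (fun p : ℝ × ℝ => ENNReal.ofReal p.1 •
      ({z : ℝ × ℝ | z.1 ^ 2 + z.2 ^ 2 ≤ K * |e₁ * z.1 ^ 2 + e₂ * z.2 ^ 2|}.indicator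
      (fun z => G (c + e₁ * z.1 ^ 2 + e₂ * z.2 ^ 2)) (polarCoord.symm p))) := by
    have : Measurable fun p : ℝ × ℝ => polarCoord.symm p := by
      simp only [polarCoord_symm_apply]; fun_prop
    simp only [smul_eq_mul]
    exact (by fun_prop : Measurable fun p : ℝ × ℝ => ENNReal.ofReal p.1).mul (hm.comp this)
  have hvol : (volume : Measure (ℝ × ℝ)) = (volume : Measure ℝ).prod volume := rfl
  rw [htar, hvol, ← Measure.prod_restrict, lintegral_prod_symm _ hm'.aemeasurable]
  have inner : ∀ θ : ℝ, ∫⁻ r in Set.Ioi (0 : ℝ), ENNReal.ofReal r •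
      ({z : ℝ × ℝ | z.1 ^ 2 + z.2 ^ 2 ≤ K * |e₁ * z.1 ^ 2 + e₂ * z.2 ^ 2|}.indicator
      (fun z => G (c + e₁ * z.1 ^ 2 + e₂ * z.2 ^ 2)) (polarCoord.symm (r, θ))) ≤
      ENNReal.ofReal (K / 2) * ∫⁻ t, G t := by
    intro θ
    set q := e₁ * Real.cos θ ^ 2 + e₂ * Real.sin θ ^ 2 with hq
    by_cases hc : 1 ≤ K * |q|
    · have hq0 : q ≠ 0 := by
        intro h; rw [h] at hc; norm_num at hc
      have hinj : Set.InjOn (fun r : ℝ => c + q * r ^ 2) (Set.Ioi 0) := by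
        intro x hx y hy h
        have : x ^ 2 = y ^ 2 := mul_left_cancel₀ hq0 (add_left_cancel h)
        exact (pow_left_inj₀ (le_of_lt hx) (le_of_lt hy) two_ne_zero).1 this
      have hder : ∀ r ∈ Set.Ioi (0 : ℝ),
          HasDerivAt (fun r : ℝ => c + q * r ^ 2) (2 * q * r) r := by
        intro r _
        exact (((hasDerivAt_pow 2 r).const_mul q).const_add c).congr_deriv (by norm_num; ring)
      have hcv := setLIntegral_abs_deriv_mul_comp_le measurableSet_Ioi hder hinj G
      calc _ ≤ ∫⁻ r in Set.Ioi (0 : ℝ), ENNReal.ofReal (K / 2) *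
            (ENNReal.ofReal |2 * q * r| * G (c + q * r ^ 2)) := by
            refine setLIntegral_mono' measurableSet_Ioi fun r hr => ?_
            have hr0 : (0 : ℝ) < r := hr
            rw [smul_eq_mul, ← mul_assoc, ← ENNReal.ofReal_mul (by positivity)]
            refine mul_le_mul' (ENNReal.ofReal_le_ofReal ?_) ?_
            · rw [abs_mul, abs_mul, abs_of_pos hr0, abs_two]
              nlinarith
            · refine (Set.indicator_le_self _ _ _).trans (le_of_eq ?_)
              simp only [polarCoord_symm_apply]
              congr 1; rw [hq]; ring
        _ = ENNReal.ofReal (K / 2) * ∫⁻ r in Set.Ioi (0 : ℝ),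
            (ENNReal.ofReal |2 * q * r| * G (c + q * r ^ 2)) :=
            lintegral_const_mul _ (by fun_prop)
        _ ≤ _ := by gcongr
    · refine le_of_eq_of_le ?_ zero_le
      rw [setLIntegral_congr_fun (g := fun _ => 0) measurableSet_Ioi, lintegral_zero]
      intro r hr
      have hr0 : (0 : ℝ) < r := hr
      simp only [smul_eq_mul, polarCoord_symm_apply]
      rw [Set.indicator_of_notMem, mul_zero]
      simp only [Set.mem_ofPred_eq, not_le]
      have e1 : e₁ * (r * Real.cos θ) ^ 2 + e₂ * (r * Real.sin θ) ^ 2 = r ^ 2 * q := by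
        rw [hq]; ring
      have e2 : (r * Real.cos θ) ^ 2 + (r * Real.sin θ) ^ 2 = r ^ 2 := by
        linear_combination r ^ 2 * Real.cos_sq_add_sin_sq θ
      rw [e1, e2, abs_mul, abs_of_pos (by positivity : (0 : ℝ) < r ^ 2)]
      have : 0 < r ^ 2 := by positivity
      push Not at hc
      nlinarith
  calc _ ≤ ∫⁻ θ in Set.Ioo (-Real.pi) Real.pi, ENNReal.ofReal (K / 2) * ∫⁻ t, G t :=
        lintegral_mono fun θ => inner θ
    _ = _ := by
        rw [setLIntegral_const, Real.volume_Ioo, mul_right_comm,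
          ← ENNReal.ofReal_mul (by positivity)]
        congr 2; ring

/-- Change of variables `(x, y) ↦ (A x (y - m x), √(κ x))`, followed by
`lintegral_comp_quadratic_le`. -/
theorem setLIntegral_mul_lintegral_le {G : ℝ → ℝ≥0∞} (hG : Measurable G) {S : Set ℝ}
    (hS : S.OrdConnected) {R : Set (ℝ × ℝ)} {E : ℝ → ℝ → ℝ} {A m κ κ' w : ℝ → ℝ}
    {c e₁ e₂ K M : ℝ} (hK : 0 < K) (hM : 0 ≤ M) (hA : ∀ x ∈ S, 0 < A x)
    (hκ : ∀ x ∈ S, 0 < κ x) (hκd : ∀ x ∈ S, HasDerivAt κ (κ' x) x) (hκ' : ∀ x ∈ S, κ' x ≠ 0)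
    (hw : ∀ x ∈ S, 4 * w x ^ 2 * κ x ≤ M ^ 2 * A x ^ 2 * κ' x ^ 2)
    (hE : ∀ x ∈ S, ∀ y, E x y = c + e₁ * (A x * (y - m x)) ^ 2 + e₂ * κ x)
    (hR : ∀ x ∈ S, ∀ y, (x, y) ∈ R →
      (A x * (y - m x)) ^ 2 + κ x ≤ K * |e₁ * (A x * (y - m x)) ^ 2 + e₂ * κ x|) :
    ∫⁻ x in S, ENNReal.ofReal (w x) * ∫⁻ y, R.indicator (fun z => G (E z.1 z.2)) (x, y) ≤
      ENNReal.ofReal M * (ENNReal.ofReal (Real.pi * K) * ∫⁻ t, G t) := by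
  set Φ : ℝ × ℝ → ℝ≥0∞ :=
    {z : ℝ × ℝ | z.1 ^ 2 + z.2 ^ 2 ≤ K * |e₁ * z.1 ^ 2 + e₂ * z.2 ^ 2|}.indicator
      (fun z => G (c + e₁ * z.1 ^ 2 + e₂ * z.2 ^ 2)) with hΦ
  have hmS : MeasurableSet
      {z : ℝ × ℝ | z.1 ^ 2 + z.2 ^ 2 ≤ K * |e₁ * z.1 ^ 2 + e₂ * z.2 ^ 2|} :=
    measurableSet_le (by fun_prop) (by fun_prop)
  have hΦm : Measurable Φ :=
    (by fun_prop : Measurable fun z : ℝ × ℝ =>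
      G (c + e₁ * z.1 ^ 2 + e₂ * z.2 ^ 2)).indicator hmS
  have hSm := hS.measurableSet
  set Ψ : ℝ → ℝ≥0∞ := fun v => ∫⁻ u, Φ (u, v) with hΨ
  have hder : ∀ x ∈ S, HasDerivAt (fun x => √(κ x)) (κ' x / (2 * √(κ x))) x :=
    fun x hx => (hκd x hx).sqrt (hκ x hx).ne'
  have hinj : Set.InjOn (fun x => √(κ x)) S :=
    injOn_of_hasDerivAt_ne_zero hS hder fun x hx =>
      div_ne_zero (hκ' x hx) (mul_ne_zero two_ne_zero (Real.sqrt_pos.2 (hκ x hx)).ne')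
  have inner : ∀ x ∈ S, ENNReal.ofReal (A x) * ∫⁻ y, R.indicator (fun z => G (E z.1 z.2)) (x, y) ≤
      Ψ √(κ x) := by
    intro x hx
    have hA0 := hA x hx
    have hAd : ∀ y ∈ Set.univ, HasDerivAt (fun y : ℝ => A x * (y - m x)) (A x) y := by
      intro y _
      simpa using ((hasDerivAt_id y).sub_const (m x)).const_mul (A x)
    have hAinj : Set.InjOn (fun y : ℝ => A x * (y - m x)) Set.univ := by
      intro y _ y' _ h
      simpa [hA0.ne'] using h
    have h := setLIntegral_abs_deriv_mul_comp_le MeasurableSet.univ hAd hAinj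
      (fun u => Φ (u, √(κ x)))
    rw [Measure.restrict_univ] at h
    rw [← lintegral_const_mul' _ _ ENNReal.ofReal_ne_top]
    refine (lintegral_mono fun y => ?_).trans h
    rw [abs_of_pos hA0]
    gcongr
    by_cases hy : (x, y) ∈ R
    · rw [Set.indicator_of_mem hy, hΦ, Set.indicator_of_mem]
      · simp only [Real.sq_sqrt (hκ x hx).le, hE x hx y]; exact le_rfl
      · simpa only [Set.mem_ofPred_eq, Real.sq_sqrt (hκ x hx).le] using hR x hx y hy
    · rw [Set.indicator_of_notMem hy]; exact zero_le
  calc _ ≤ ∫⁻ x in S, ENNReal.ofReal M * (ENNReal.ofReal |κ' x / (2 * √(κ x))| * Ψ √(κ x)) := by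
        refine setLIntegral_mono' hSm fun x hx => ?_
        have hs := Real.sqrt_pos.2 (hκ x hx)
        have hA0 := hA x hx
        have hwx : w x ≤ M * |κ' x / (2 * √(κ x))| * A x := by
          refine le_of_sq_le_sq ?_ (by positivity)
          rw [mul_pow, mul_pow, sq_abs, div_pow, mul_pow, Real.sq_sqrt (hκ x hx).le]
          have := hw x hx
          have h0 := hκ x hx
          rw [show M ^ 2 * (κ' x ^ 2 / (2 ^ 2 * κ x)) * A x ^ 2 =
            (M ^ 2 * A x ^ 2 * κ' x ^ 2) / (4 * κ x) by field_simp; ring,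
          le_div_iff₀ (by positivity)]
          linarith
        calc _ ≤ ENNReal.ofReal (M * |κ' x / (2 * √(κ x))| * A x) *
              ∫⁻ y, R.indicator (fun z => G (E z.1 z.2)) (x, y) := by gcongr
          _ = ENNReal.ofReal M * (ENNReal.ofReal |κ' x / (2 * √(κ x))| * (ENNReal.ofReal (A x) *
              ∫⁻ y, R.indicator (fun z => G (E z.1 z.2)) (x, y))) := by
              rw [ENNReal.ofReal_mul (by positivity), ENNReal.ofReal_mul hM]; ring
          _ ≤ _ := by gcongr; exact inner x hx
    _ = ENNReal.ofReal M * ∫⁻ x in S, (ENNReal.ofReal |κ' x / (2 * √(κ x))| * Ψ √(κ x)) :=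
        lintegral_const_mul' _ _ ENNReal.ofReal_ne_top
    _ ≤ ENNReal.ofReal M * ∫⁻ v, Ψ v := by
        exact mul_le_mul' le_rfl (setLIntegral_abs_deriv_mul_comp_le hSm hder hinj Ψ)
    _ = ENNReal.ofReal M * ∫⁻ z, Φ z := by
        congr 1
        exact (lintegral_prod_symm (μ := volume) (ν := volume) Φ hΦm.aemeasurable).symm
    _ ≤ _ := by gcongr; exact lintegral_comp_quadratic_le hG c e₁ e₂ hK

end ChangeOfVariables

section Bilinear

variable {P : Type*} [MeasurableSpace P]

theorem sq_lintegral_mul_le {μ : Measure P} {f g : P → ℝ≥0∞} (hf : Measurable f)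
    (hg : Measurable g) :
    (∫⁻ x, f x * g x ∂μ) ^ 2 ≤ (∫⁻ x, f x ^ 2 ∂μ) * ∫⁻ x, g x ^ 2 ∂μ := by
  have h := ENNReal.lintegral_mul_le_Lp_mul_Lq μ Real.HolderConjugate.two_two
    hf.aemeasurable hg.aemeasurable
  simp only [Pi.mul_apply, ENNReal.rpow_two] at h
  calc _ ≤ ((∫⁻ x, f x ^ 2 ∂μ) ^ (1 / 2 : ℝ) * (∫⁻ x, g x ^ 2 ∂μ) ^ (1 / 2 : ℝ)) ^ 2 := by
        gcongr
    _ = _ := by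
        rw [mul_pow, ← ENNReal.rpow_two, ← ENNReal.rpow_two, ← ENNReal.rpow_mul,
          ← ENNReal.rpow_mul]
        norm_num

/-- Dual form of an `L²` bound for `T`. -/
theorem lintegral_mul_le_of_lintegral_sq_le {μ : Measure P} {f T : P → ℝ≥0∞} (hf : Measurable f)
    (hT : Measurable T) {B F₁ F₂ : ℝ≥0∞} (h : ∫⁻ p, T p ^ 2 ∂μ ≤ B * (F₁ * F₂)) :
    ∫⁻ p, f p * T p ∂μ ≤ B ^ (1 / 2 : ℝ) * ((∫⁻ p, f p ^ 2 ∂μ) ^ (1 / 2 : ℝ) *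
      F₁ ^ (1 / 2 : ℝ) * F₂ ^ (1 / 2 : ℝ)) := by
  have h0 : (0 : ℝ) ≤ 1 / 2 := by norm_num
  have h1 := (sq_lintegral_mul_le (μ := μ) hf hT).trans (mul_le_mul' le_rfl h)
  have h2 := ENNReal.rpow_le_rpow h1 h0
  rw [← ENNReal.rpow_natCast, ← ENNReal.rpow_mul] at h2
  norm_num at h2
  refine h2.trans (le_of_eq ?_)
  rw [ENNReal.mul_rpow_of_nonneg _ _ (by norm_num), ENNReal.mul_rpow_of_nonneg _ _ (by norm_num),
    ENNReal.mul_rpow_of_nonneg _ _ (by norm_num)]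
  norm_num
  ring

variable [AddCommGroup P] [MeasurableAdd₂ P] [MeasurableNeg P] {μ : Measure P} [SFinite μ]
  [μ.IsAddLeftInvariant]

/-- A bilinear convolution with kernel `k` is bounded on `L²` when `k` is square integrable along
the fibres of addition, uniformly. -/
theorem lintegral_sq_bilinear_le {k : P → P → ℝ≥0∞} (hk : Measurable (Function.uncurry k))
    {B : ℝ≥0∞} (hB : ∀ p, ∫⁻ r, k r (p - r) ^ 2 ∂μ ≤ B) {g h : P → ℝ≥0∞} (hg : Measurable g)
    (hh : Measurable h) :
    ∫⁻ p, (∫⁻ r, k r (p - r) * (g r * h (p - r)) ∂μ) ^ 2 ∂μ ≤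
      B * ((∫⁻ p, g p ^ 2 ∂μ) * ∫⁻ p, h p ^ 2 ∂μ) := by
  have hk' : ∀ p, Measurable fun r => k r (p - r) := fun p =>
    hk.comp (measurable_id.prodMk (measurable_const.sub measurable_id))
  calc _ ≤ ∫⁻ p, B * ∫⁻ r, (g r * h (p - r)) ^ 2 ∂μ ∂μ := by
        refine lintegral_mono fun p => ?_
        refine (sq_lintegral_mul_le (hk' p) (by fun_prop)).trans ?_
        gcongr
        exact hB p
    _ = B * ∫⁻ p, ∫⁻ r, g r ^ 2 * h (p - r) ^ 2 ∂μ ∂μ := by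
        simp only [mul_pow]
        exact lintegral_const_mul _ (Measurable.lintegral_prod_right' (f := fun z : P × P =>
          g z.2 ^ 2 * h (z.1 - z.2) ^ 2) (by fun_prop))
    _ = B * ∫⁻ r, g r ^ 2 * ∫⁻ p, h p ^ 2 ∂μ ∂μ := by
        rw [lintegral_lintegral_swap (by fun_prop)]
        congr 1
        refine lintegral_congr fun r => ?_
        rw [lintegral_const_mul _ (by fun_prop), lintegral_sub_right_eq_self (fun p => h p ^ 2)]
    _ = _ := by rw [lintegral_mul_const _ (by fun_prop)]

/-- The `L²` norms of `u v` and `u v̄` agree, on the Fourier side. -/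
theorem lintegral_sq_convolution_neg [μ.IsNegInvariant] {g h : P → ℝ≥0∞}
    (hg : Measurable g) (hh : Measurable h) :
    ∫⁻ p, (∫⁻ r, g r * h (p - r) ∂μ) ^ 2 ∂μ = ∫⁻ p, (∫⁻ r, g r * h (r - p) ∂μ) ^ 2 ∂μ := by
  have expand : ∀ F : P → P → ℝ≥0∞, Measurable (Function.uncurry F) →
      ∫⁻ p, (∫⁻ r, F p r ∂μ) ^ 2 ∂μ = ∫⁻ r, ∫⁻ s, ∫⁻ p, F p r * F p s ∂μ ∂μ ∂μ := by
    intro F hF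
    have h1 : ∀ p, (∫⁻ r, F p r ∂μ) ^ 2 = ∫⁻ r, ∫⁻ s, F p r * F p s ∂μ ∂μ := by
      intro p
      have hp : Measurable (F p) := hF.comp measurable_prodMk_left
      simp_rw [lintegral_const_mul _ hp]
      rw [lintegral_mul_const _ hp, sq]
    simp_rw [h1]
    have m3 : Measurable fun z : (P × P) × P => F z.1.1 z.1.2 * F z.1.1 z.2 :=
      (hF.comp (by fun_prop : Measurable fun z : (P × P) × P => (z.1.1, z.1.2))).mul
        (hF.comp (by fun_prop : Measurable fun z : (P × P) × P => (z.1.1, z.2)))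
    rw [lintegral_lintegral_swap
      (f := fun p r => ∫⁻ s, F p r * F p s ∂μ) m3.lintegral_prod_right'.aemeasurable]
    refine lintegral_congr fun r => ?_
    refine lintegral_lintegral_swap (f := fun p s => F p r * F p s)
      (Measurable.aemeasurable ?_)
    exact (hF.comp (by fun_prop : Measurable fun z : P × P => (z.1, r))).mul
        (hF.comp (by fun_prop : Measurable fun z : P × P => (z.1, z.2)))
  rw [expand (fun p r => g r * h (p - r)) (by unfold Function.uncurry; fun_prop),
    expand (fun p r => g r * h (r - p)) (by unfold Function.uncurry; fun_prop)]
  refine lintegral_congr fun r => lintegral_congr fun s => ?_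
  rw [← lintegral_sub_left_eq_self _ (r + s)]
  refine lintegral_congr fun p => ?_
  rw [show r + s - p - r = s - p by abel, show r + s - p - s = r - p by abel]
  ring

end Bilinear

section Bracket

/-- The weight `⟨e⟩^{-b}` as an extended nonnegative real. -/
noncomputable def bracketWeight (b e : ℝ) : ℝ≥0∞ := ENNReal.ofReal ((1 + |e|) ^ (-b))

@[fun_prop]
theorem measurable_bracketWeight (b : ℝ) : Measurable (bracketWeight b) := by
  unfold bracketWeight; fun_prop

theorem bracketWeight_neg (b e : ℝ) : bracketWeight b (-e) = bracketWeight b e := by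
  rw [bracketWeight, abs_neg, bracketWeight]

theorem bracketWeight_sq (b e : ℝ) : bracketWeight b e ^ 2 = bracketWeight (2 * b) e := by
  have : 0 ≤ 1 + |e| := by positivity
  rw [bracketWeight, bracketWeight, ← ENNReal.ofReal_pow (by positivity), ← Real.rpow_natCast,
    ← Real.rpow_mul this]
  congr 2; push_cast; ring

theorem lintegral_bracketWeight_lt_top {b : ℝ} (hb : 1 < b) : ∫⁻ e, bracketWeight b e < ∞ := by
  have h := (integrable_one_add_norm (E := ℝ) (μ := volume) (r := b) (by simpa using hb))
  exact h.lintegral_lt_top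

theorem bracketWeight_mul_le {b : ℝ} (hb : 0 ≤ b) (s t : ℝ) :
    bracketWeight b s * bracketWeight b t ≤ ENNReal.ofReal (2 ^ b) * bracketWeight b (s + t) *
      (bracketWeight b s + bracketWeight b t) := by
  have key : ∀ s t : ℝ, |s| ≤ |t| → bracketWeight b t ≤
      ENNReal.ofReal (2 ^ b) * bracketWeight b (s + t) := by
    intro s t hst
    unfold bracketWeight
    rw [← ENNReal.ofReal_mul (by positivity)]
    refine ENNReal.ofReal_le_ofReal ?_
    have h1 : (0 : ℝ) < (1 + |s + t|) / 2 := by positivity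
    have h2 : (1 + |s + t|) / 2 ≤ 1 + |t| := by
      have := abs_add_le s t; have := abs_nonneg t; linarith
    have h3 := Real.rpow_le_rpow_of_nonpos h1 h2 (neg_nonpos.2 hb)
    refine h3.trans (le_of_eq ?_)
    rw [Real.div_rpow (by positivity) (by norm_num), Real.rpow_neg (x := 2) (by norm_num)]
    field_simp
  rcases le_total |s| |t| with h | h
  · calc _ ≤ bracketWeight b s * (ENNReal.ofReal (2 ^ b) * bracketWeight b (s + t)) := by
          gcongr; exact key s t h
      _ ≤ _ := by rw [mul_comm]; gcongr; exact le_self_add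
  · calc _ ≤ (ENNReal.ofReal (2 ^ b) * bracketWeight b (s + t)) * bracketWeight b t := by
          gcongr; rw [add_comm]; exact key t s h
      _ ≤ _ := by gcongr; exact le_add_self

theorem lintegral_bracketWeight_mul_le {b : ℝ} (hb : 0 ≤ b) (u v : ℝ) :
    ∫⁻ t, bracketWeight b (t + u) * bracketWeight b (v - t) ≤
      ENNReal.ofReal (2 ^ b) * (2 * ∫⁻ e, bracketWeight b e) * bracketWeight b (u + v) := by
  calc _ ≤ ∫⁻ t, ENNReal.ofReal (2 ^ b) * bracketWeight b (u + v) *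
        (bracketWeight b (t + u) + bracketWeight b (v - t)) := by
        refine lintegral_mono fun t => ?_
        refine (bracketWeight_mul_le hb _ _).trans (le_of_eq ?_)
        rw [show t + u + (v - t) = u + v by ring]
    _ = _ := by
        rw [lintegral_const_mul _ (by fun_prop), lintegral_add_left (by fun_prop),
          lintegral_add_right_eq_self (bracketWeight b),
          lintegral_sub_left_eq_self (bracketWeight b)]
        ring

end Bracket

section Dispersion

theorem hasDerivAt_mul_abs_rpow {α : ℝ} (hα : 2 < α) (x : ℝ) :
    HasDerivAt (fun x : ℝ => x * |x| ^ α) ((α + 1) * |x| ^ α) x := by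
  refine ((hasDerivAt_id x).mul (hasDerivAt_abs_rpow x (by linarith : 1 < α))).congr_deriv ?_
  have : |x| ^ (α - 2) * x ^ 2 = |x| ^ α := by
    rw [← sq_abs, ← Real.rpow_natCast, ← Real.rpow_add' (abs_nonneg x) (by push_cast; linarith)]
    congr 1; push_cast; ring
  simp only [id]
  linear_combination α * this

theorem mul_rpow_tangent_lt {α u v : ℝ} (hα : 0 < α) (hu : 0 < u) (hv : 0 < v) (huv : u ≠ v) :
    u * u ^ α + (α + 1) * u ^ α * (v - u) < v * v ^ α := by
  have h := one_add_mul_self_lt_rpow_one_add (s := v / u - 1) (p := α + 1)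
    (by have := div_pos hv hu; linarith)
    (by intro h; apply huv; field_simp at h; linarith) (by linarith)
  rw [add_sub_cancel, Real.div_rpow hv.le hu.le, Real.rpow_add_one hv.ne',
    Real.rpow_add_one hu.ne', lt_div_iff₀ (by positivity)] at h
  have e : (1 + (α + 1) * (v / u - 1)) * (u ^ α * u) =
      u * u ^ α + (α + 1) * u ^ α * (v - u) := by field_simp
  linarith

theorem mul_rpow_add_bounds {α x y : ℝ} (hα : 0 < α) (hx : 0 < x) (hxy : x ≤ y) :
    0 < (x + y) * (x + y) ^ α - x * x ^ α - y * y ^ α ∧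
      (x + y) * (x + y) ^ α - x * x ^ α - y * y ^ α ≤ (α + 1) * (x + y) ^ α * x := by
  have hy : 0 < y := hx.trans_le hxy
  have h1 := mul_rpow_tangent_lt hα hy (add_pos hx hy) (by linarith)
  have h2 := mul_rpow_tangent_lt hα (add_pos hx hy) hy (by linarith)
  have h3 : x ^ α ≤ y ^ α := Real.rpow_le_rpow hx.le hxy hα.le
  have h4 : 0 < x ^ α := by positivity
  constructor
  · nlinarith [mul_le_mul_of_nonneg_left h3 hx.le, mul_pos hα (mul_pos hx (h4.trans_le h3))]
  · nlinarith [mul_pos hx h4]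

theorem res_neg (α ξ x : ℝ) : res α (-ξ) (-x) = -res α ξ x := by
  rw [res, res, ← neg_sub', abs_neg, abs_neg, abs_neg]; ring

theorem res_bounds {α ξ x ε : ℝ} (hα : 0 < α) (hε : ε = 1 ∨ ε = -1) (hx : 0 < ε * x)
    (hxy : 2 * |x| ≤ |ξ - x|) :
    0 < ε * res α ξ x ∧ ε * res α ξ x ≤ (α + 1) * 2 ^ α * |ξ - x| ^ α * |x| := by
  wlog hy : 0 < ξ - x generalizing ξ x ε
  · have hx0 : 0 < |x| := abs_pos.2 (by rintro rfl; simp at hx)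
    have hy' : ξ - x ≠ 0 := by intro h; rw [h, abs_zero] at hxy; linarith
    have := @this (-ξ) (-x) (-ε) (by rcases hε with rfl | rfl <;> simp) (by linarith)
      (by rwa [abs_neg, ← neg_sub', abs_neg])
      (by have := lt_of_le_of_ne (not_lt.1 hy) hy'; linarith)
    rwa [res_neg, abs_neg, ← neg_sub', abs_neg, neg_mul_neg] at this
  rw [abs_of_pos hy] at hxy ⊢
  rcases hε with rfl | rfl
  · have hx : 0 < x := by linarith
    rw [abs_of_pos hx] at hxy ⊢
    obtain ⟨h1, h2⟩ := mul_rpow_add_bounds (y := ξ - x) hα hx (by linarith)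
    have h3 : (x + (ξ - x)) ^ α ≤ 2 ^ α * (ξ - x) ^ α := by
      rw [← Real.mul_rpow (by norm_num) hy.le]
      exact Real.rpow_le_rpow (by linarith) (by linarith) hα.le
    rw [add_sub_cancel] at h1 h2 h3
    rw [res, abs_of_pos hx, abs_of_pos hy, abs_of_pos (by linarith : 0 < ξ), one_mul]
    refine ⟨h1, h2.trans ?_⟩
    calc _ ≤ (α + 1) * (2 ^ α * (ξ - x) ^ α) * x := by gcongr
      _ = _ := by ring
  · have hx : 0 < -x := by linarith
    rw [abs_of_neg (by linarith)] at hxy ⊢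
    obtain ⟨h1, h2⟩ := mul_rpow_add_bounds (y := ξ) hα hx (by linarith)
    have h3 : (-x + ξ) ^ α ≤ 2 ^ α * (ξ - x) ^ α := by
      rw [← Real.mul_rpow (by norm_num) hy.le]
      exact Real.rpow_le_rpow (by linarith) (by linarith) hα.le
    rw [neg_add_eq_sub] at h1 h2 h3
    rw [res, abs_of_neg (by linarith : x < 0), abs_of_pos hy, abs_of_pos (by linarith : 0 < ξ)]
    have e : -1 * (ξ * ξ ^ α - x * (-x) ^ α - (ξ - x) * (ξ - x) ^ α) =
      (ξ - x) * (ξ - x) ^ α - -x * (-x) ^ α - ξ * ξ ^ α := by ring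
    rw [e]
    refine ⟨h1, h2.trans ?_⟩
    calc _ ≤ (α + 1) * (2 ^ α * (ξ - x) ^ α) * -x := by gcongr
      _ = _ := by ring

theorem mul_rpow_midpoint_bounds {α x y : ℝ} (hα : 1 ≤ α) (hx : 0 < x) (hy : 0 < y)
    (hxy : x ≠ y) :
    0 < x * x ^ α + y * y ^ α - 2 * ((x + y) / 2 * ((x + y) / 2) ^ α) ∧
    4 * (x * y) ^ (α / 2) * (x * x ^ α + y * y ^ α - 2 * ((x + y) / 2 * ((x + y) / 2) ^ α)) ≤
      (x + y) * ((α + 1) * (x ^ α - y ^ α)) ^ 2 := by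
  wlog h : x < y generalizing x y
  · obtain ⟨h1, h2⟩ := this hy hx hxy.symm (lt_of_le_of_ne (not_lt.1 h) hxy.symm)
    rw [add_comm y x, add_comm (y * y ^ α)] at h1 h2
    refine ⟨h1, ?_⟩
    rw [mul_comm x y]
    refine h2.trans (le_of_eq ?_)
    ring
  have hα0 : 0 < α := by linarith
  set c := (x + y) / 2 with hc
  have hc0 : 0 < c := by positivity
  have t1 := mul_rpow_tangent_lt hα0 hc0 hx (by rw [hc]; intro h'; linarith)
  have t2 := mul_rpow_tangent_lt hα0 hc0 hy (by rw [hc]; intro h'; linarith)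
  have t3 := mul_rpow_tangent_lt hα0 hx hc0 (by rw [hc]; intro h'; linarith)
  have t4 := mul_rpow_tangent_lt hα0 hy hc0 (by rw [hc]; intro h'; linarith)
  set κ := x * x ^ α + y * y ^ α - 2 * (c * c ^ α) with hκ
  have hκ0 : 0 < κ := by
    have : (α + 1) * c ^ α * (x - c) + (α + 1) * c ^ α * (y - c) = 0 := by rw [hc]; ring
    linarith
  refine ⟨hκ0, ?_⟩
  set d := (α + 1) * (y ^ α - x ^ α) with hd
  have hκd : κ ≤ d * (y - x) / 2 := by
    have : (α + 1) * x ^ α * (c - x) + (α + 1) * y ^ α * (c - y) = -(d * (y - x) / 2) := by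
      rw [hc, hd]; ring
    linarith
  have hslope : y ^ (α - 1) * (y - x) ≤ y ^ α - x ^ α := by
    have e1 : y ^ α = y ^ (α - 1) * y := by
      rw [← Real.rpow_add_one hy.ne', sub_add_cancel]
    have e2 : x ^ α = x ^ (α - 1) * x := by
      rw [← Real.rpow_add_one hx.ne', sub_add_cancel]
    have := Real.rpow_le_rpow hx.le h.le (by linarith : 0 ≤ α - 1)
    rw [e1, e2]; nlinarith
  have hn : 0 < y ^ (α - 1) := by positivity
  have hd1 : 2 * (y ^ (α - 1) * (y - x)) ≤ d := by
    have : 0 < y ^ (α - 1) * (y - x) := mul_pos hn (by linarith)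
    rw [hd]; nlinarith
  have hd0 : 0 ≤ d := le_trans (by have := mul_pos hn (sub_pos.2 h); linarith) hd1
  have hprod : (x * y) ^ (α / 2) ≤ y ^ (α - 1) * y := by
    rw [← Real.rpow_add_one hy.ne', sub_add_cancel]
    calc (x * y) ^ (α / 2) ≤ (y ^ 2) ^ (α / 2) := by
          refine Real.rpow_le_rpow (by positivity) (by nlinarith) (by positivity)
      _ = _ := by
          rw [← Real.rpow_natCast, ← Real.rpow_mul hy.le]; congr 1; push_cast; ring
  calc 4 * (x * y) ^ (α / 2) * κ ≤ 4 * (y ^ (α - 1) * y) * (d * (y - x) / 2) := by gcongr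
    _ = y * d * (2 * (y ^ (α - 1) * (y - x))) := by ring
    _ ≤ y * d * d := by gcongr
    _ ≤ (x + y) * d ^ 2 := by nlinarith [mul_nonneg hx.le (sq_nonneg d)]
    _ = _ := by rw [hd]; ring

theorem phi_add_phi {α ξ x : ℝ} (μ y : ℝ) (hξ : ξ ≠ 0) (hx : x ≠ 0) (hξx : ξ - x ≠ 0) :
    phi α x y + phi α (ξ - x) (μ - y) = x * |x| ^ α + (ξ - x) * |ξ - x| ^ α + μ ^ 2 / ξ +
      ξ / (x * (ξ - x)) * (y - μ * x / ξ) ^ 2 := by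
  unfold phi
  have : y ^ 2 / x + (μ - y) ^ 2 / (ξ - x) =
      μ ^ 2 / ξ + ξ / (x * (ξ - x)) * (y - μ * x / ξ) ^ 2 := by
    field_simp; ring
  linarith

end Dispersion

section Fibre

theorem hasDerivAt_res {α : ℝ} (hα : 2 < α) (ξ x : ℝ) :
    HasDerivAt (res α ξ) ((α + 1) * (|ξ - x| ^ α - |x| ^ α)) x := by
  have h1 := hasDerivAt_mul_abs_rpow hα x
  have h2 := (hasDerivAt_mul_abs_rpow hα (ξ - x)).comp x ((hasDerivAt_id x).const_sub ξ)
  exact (((hasDerivAt_const x (ξ * |ξ| ^ α)).sub h1).sub h2).congr_deriv (by ring)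

/-- The fibre integral in the region where `ξ₁` is the low frequency, under the resonance
hypothesis, for a fixed sign of `ξ₁`. -/
theorem setLIntegral_resonant_sign_le {α : ℝ} (hα : 4 ≤ α) {ξ : ℝ} (hξ : ξ ≠ 0) (μ τ : ℝ)
    {G : ℝ → ℝ≥0∞} (hG : Measurable G) {ε : ℝ} (hε : ε = 1 ∨ ε = -1) :
    ∫⁻ x in {x | 0 < ε * x ∧ 2 * |x| ≤ |ξ - x|},
      ENNReal.ofReal ((|x| ^ (-(1 : ℝ) / 2) * |ξ - x| ^ (α / 4)) ^ 2) *
        ∫⁻ y, {z : ℝ × ℝ | |res α ξ z.1| / α ≤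
            |phi α ξ μ - phi α z.1 z.2 - phi α (ξ - z.1) (μ - z.2)|}.indicator
          (fun z => G (τ + phi α z.1 z.2 + phi α (ξ - z.1) (μ - z.2))) (x, y) ≤
      ENNReal.ofReal √(8 * (α + 1) * 2 ^ α) *
        (ENNReal.ofReal (Real.pi * (2 * α + 1)) * ∫⁻ t, G t) := by
  have hα0 : 0 < α := by linarith
  have hεε : ε * ε = 1 := by rcases hε with rfl | rfl <;> norm_num
  have sgn : ∀ x, 0 < ε * x → 2 * |x| ≤ |ξ - x| → x ≠ 0 ∧ ξ - x ≠ 0 ∧ 0 < ξ * (ξ - x) ∧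
      |ξ - x| ≤ 2 * |ξ| := by
    intro x hx hxy
    have hx0 : x ≠ 0 := by rintro rfl; simp at hx
    have hx1 : 0 < |x| := abs_pos.2 hx0
    have hy0 : ξ - x ≠ 0 := by intro h; rw [h, abs_zero] at hxy; linarith
    refine ⟨hx0, hy0, ?_, ?_⟩
    · rcases lt_or_gt_of_ne hy0 with h | h
      · rw [abs_of_neg h] at hxy
        refine mul_pos_of_neg_of_neg ?_ h
        have := le_abs_self x; linarith
      · rw [abs_of_pos h] at hxy
        refine mul_pos ?_ h
        have := neg_abs_le x; linarith
    · have := abs_sub ξ x; linarith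
  have gap : ∀ x, 0 < ε * x → 2 * |x| ≤ |ξ - x| → 2 * |x| ^ α ≤ |ξ - x| ^ α := by
    intro x _ hxy
    calc 2 * |x| ^ α ≤ 2 ^ α * |x| ^ α := by
          gcongr
          simpa using Real.rpow_le_rpow_of_exponent_le one_le_two (by linarith : (1 : ℝ) ≤ α)
      _ = (2 * |x|) ^ α := by rw [Real.mul_rpow (by norm_num) (abs_nonneg x)]
      _ ≤ _ := by gcongr
  have coeff : ∀ x, 0 < ε * x → 2 * |x| ≤ |ξ - x| →
      ε * (|ξ| / |x * (ξ - x)|) = ξ / (x * (ξ - x)) := by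
    intro x hx hxy
    obtain ⟨hx0, hy0, hpos, -⟩ := sgn x hx hxy
    rw [← abs_div, ← mul_div_mul_right ξ _ hy0, mul_assoc x]
    have h1 : 0 < (ξ - x) * (ξ - x) := mul_self_pos.2 hy0
    rcases hε with rfl | rfl
    · rw [abs_of_pos (by have : 0 < x := by linarith
                         positivity), one_mul]
    · rw [abs_of_neg (div_neg_of_pos_of_neg hpos
        (mul_neg_of_neg_of_pos (by linarith) h1)), neg_one_mul, neg_neg]
  refine setLIntegral_mul_lintegral_le (A := fun x => √(|ξ| / |x * (ξ - x)|))
    (m := fun x => μ * x / ξ) (κ := fun x => ε * res α ξ x)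
    (κ' := fun x => ε * ((α + 1) * (|ξ - x| ^ α - |x| ^ α)))
    (E := fun x y => τ + phi α x y + phi α (ξ - x) (μ - y))
    (c := τ + phi α ξ μ) (e₁ := ε) (e₂ := -ε) hG ?_ (by linarith) (Real.sqrt_nonneg _)
    ?_ ?_ ?_ ?_ ?_ ?_ ?_
  · refine ⟨fun a ha b hb c hc => ?_⟩
    obtain ⟨ha1, ha2⟩ := ha
    obtain ⟨hb1, hb2⟩ := hb
    obtain ⟨hc1, hc2⟩ := hc
    rcases hε with rfl | rfl
    · refine ⟨by linarith, ?_⟩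
      rw [abs_of_pos (by linarith)] at ha2 hb2 ⊢
      rcases le_abs'.1 hb2 with h | h
      · exact le_abs'.2 (Or.inl (by
          rcases le_abs'.1 ha2 with h' | h' <;> linarith))
      · exact le_abs'.2 (Or.inr (by linarith))
    · refine ⟨by linarith, ?_⟩
      rw [abs_of_neg (by linarith)] at ha2 hb2 ⊢
      rcases le_abs'.1 ha2 with h | h
      · exact le_abs'.2 (Or.inl (by linarith))
      · exact le_abs'.2 (Or.inr (by
          rcases le_abs'.1 hb2 with h' | h' <;> linarith))
  · intro x ⟨hx, hxy⟩
    obtain ⟨hx0, hy0, -, -⟩ := sgn x hx hxy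
    positivity
  · intro x ⟨hx, hxy⟩
    exact (res_bounds hα0 hε hx hxy).1
  · intro x _
    exact (hasDerivAt_res (by linarith) ξ x).const_mul ε
  · intro x ⟨hx, hxy⟩
    have := gap x hx hxy
    have hx1 := abs_pos.2 (sgn x hx hxy).1
    have : 0 < |x| ^ α := by positivity
    have hε0 : ε ≠ 0 := by rcases hε with rfl | rfl <;> norm_num
    exact mul_ne_zero hε0 (mul_ne_zero (by positivity) (by linarith))
  · intro x ⟨hx, hxy⟩
    obtain ⟨hx0, hy0, hpos, hle⟩ := sgn x hx hxy
    have hx1 := abs_pos.2 hx0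
    have hy1 := abs_pos.2 hy0
    have hg := gap x hx hxy
    have hκ := (res_bounds hα0 hε hx hxy).2
    have hw : ((|x| ^ (-(1 : ℝ) / 2) * |ξ - x| ^ (α / 4)) ^ 2) ^ 2 =
        |ξ - x| ^ α / |x| ^ 2 := by
      rw [← pow_mul, mul_pow, ← Real.rpow_natCast, ← Real.rpow_mul hx1.le, ← Real.rpow_natCast,
        ← Real.rpow_mul hy1.le, div_eq_inv_mul (|ξ - x| ^ α),
        ← Real.rpow_natCast |x| 2, ← Real.rpow_neg hx1.le]
      congr 2 <;> push_cast <;> ring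
    rw [hw, Real.sq_sqrt (by positivity), Real.sq_sqrt (by positivity), mul_pow, sq ε, hεε, one_mul,
      abs_mul]
    set N := |ξ - x| ^ α
    have hN : 0 < N := by positivity
    calc 4 * (N / |x| ^ 2) * (ε * res α ξ x)
        ≤ 4 * (N / |x| ^ 2) * ((α + 1) * 2 ^ α * N * |x|) := by gcongr
      _ = 8 * (α + 1) * 2 ^ α * (1 / (2 * |x|)) * N ^ 2 := by field_simp; ring
      _ ≤ 8 * (α + 1) * 2 ^ α * (|ξ| / (|x| * |ξ - x|)) * ((α + 1) * (N - |x| ^ α)) ^ 2 := by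
        gcongr ?_ * ?_ * ?_ ^ 2
        · rw [div_le_div_iff₀ (by positivity) (by positivity)]
          nlinarith
        · have : 0 < |x| ^ α := by positivity
          nlinarith
  · intro x ⟨hx, hxy⟩ y
    obtain ⟨hx0, hy0, hpos, -⟩ := sgn x hx hxy
    have h1 := phi_add_phi (α := α) μ y hξ hx0 hy0
    have h2 := coeff x hx hxy
    simp only [mul_pow]
    rw [Real.sq_sqrt (by positivity)]
    have h3 : phi α ξ μ = ξ * |ξ| ^ α + μ ^ 2 / ξ := rfl
    have h4 : res α ξ x = ξ * |ξ| ^ α - x * |x| ^ α - (ξ - x) * |ξ - x| ^ α := rfl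
    linear_combination h1 - h3 + h4 - (y - μ * x / ξ) ^ 2 * h2 + res α ξ x * hεε
  · intro x ⟨hx, hxy⟩ y hy
    obtain ⟨hx0, hy0, hpos, -⟩ := sgn x hx hxy
    have h1 := phi_add_phi (α := α) μ y hξ hx0 hy0
    have h2 := coeff x hx hxy
    have hκ := (res_bounds hα0 hε hx hxy).1
    have h3 : phi α ξ μ = ξ * |ξ| ^ α + μ ^ 2 / ξ := rfl
    have h4 : res α ξ x = ξ * |ξ| ^ α - x * |x| ^ α - (ξ - x) * |ξ - x| ^ α := rfl
    simp only [mul_pow]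
    rw [Real.sq_sqrt (by positivity)]
    set q := |ξ| / |x * (ξ - x)| * (y - μ * x / ξ) ^ 2 with hq
    set κ := ε * res α ξ x
    have habs : ∀ t : ℝ, |ε * t| = |t| := by
      intro t; rcases hε with rfl | rfl <;> simp
    have hy : |res α ξ x| / α ≤ |phi α ξ μ - phi α x y - phi α (ξ - x) (μ - y)| := hy
    rw [← habs (res α ξ x), abs_of_pos hκ, div_le_iff₀ hα0,
      show phi α ξ μ - phi α x y - phi α (ξ - x) (μ - y) = -(ε * q + -ε * κ) by
        linear_combination h3 - h1 - h4 + (y - μ * x / ξ) ^ 2 * h2 - res α ξ x * hεε, abs_neg] at hy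
    have h5 : |ε * q + -ε * κ| = |q - κ| := by rw [← habs (q - κ)]; congr 1; ring
    rw [h5] at hy ⊢
    have := le_abs_self (q - κ)
    linarith

/-- The fibre integral in the region where `ξ₁` is the low frequency, under the resonance
hypothesis. -/
theorem setLIntegral_resonant_le {α : ℝ} (hα : 4 ≤ α) {ξ : ℝ} (hξ : ξ ≠ 0) (μ τ : ℝ)
    {G : ℝ → ℝ≥0∞} (hG : Measurable G) :
    ∫⁻ x in {x | x ≠ 0 ∧ 2 * |x| ≤ |ξ - x|},
      ENNReal.ofReal ((|x| ^ (-(1 : ℝ) / 2) * |ξ - x| ^ (α / 4)) ^ 2) *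
        ∫⁻ y, {z : ℝ × ℝ | |res α ξ z.1| / α ≤
            |phi α ξ μ - phi α z.1 z.2 - phi α (ξ - z.1) (μ - z.2)|}.indicator
          (fun z => G (τ + phi α z.1 z.2 + phi α (ξ - z.1) (μ - z.2))) (x, y) ≤
      2 * (ENNReal.ofReal √(8 * (α + 1) * 2 ^ α) *
        (ENNReal.ofReal (Real.pi * (2 * α + 1)) * ∫⁻ t, G t)) := by
  have hsub : {x : ℝ | x ≠ 0 ∧ 2 * |x| ≤ |ξ - x|} ⊆
      {x | 0 < 1 * x ∧ 2 * |x| ≤ |ξ - x|} ∪ {x | 0 < -1 * x ∧ 2 * |x| ≤ |ξ - x|} := by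
    rintro x ⟨h1, h2⟩
    rcases lt_or_gt_of_ne h1 with h | h
    · exact Or.inr ⟨by linarith, h2⟩
    · exact Or.inl ⟨by linarith, h2⟩
  refine (lintegral_mono_set hsub).trans ((lintegral_union_le _ _ _).trans ?_)
  rw [two_mul]
  exact add_le_add (setLIntegral_resonant_sign_le hα hξ μ τ hG (Or.inl rfl))
    (setLIntegral_resonant_sign_le hα hξ μ τ hG (Or.inr rfl))

/-- The fibre integral over one side of the midpoint in the region where `ξ₁` and `ξ₂` have
sign `s`. -/
theorem setLIntegral_same_sign_half_le {α : ℝ} (hα : 4 ≤ α) (ξ μ τ : ℝ) {G : ℝ → ℝ≥0∞}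
    (hG : Measurable G) {s ε : ℝ} (hs : s = 1 ∨ s = -1) (hε : ε = 1 ∨ ε = -1) :
    ∫⁻ x in {x | 0 < s * x ∧ 0 < s * (ξ - x) ∧ 0 < ε * (2 * x - ξ)},
      ENNReal.ofReal ((|x| ^ (α / 8 - 1 / 4) * |ξ - x| ^ (α / 8 - 1 / 4)) ^ 2) *
        ∫⁻ y, G (τ + phi α x y + phi α (ξ - x) (μ - y)) ≤
      ENNReal.ofReal 1 * (ENNReal.ofReal (Real.pi * 1) * ∫⁻ t, G t) := by
  have hss : s * s = 1 := by rcases hs with rfl | rfl <;> norm_num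
  have hs1 : |s| = 1 := by rcases hs with rfl | rfl <;> norm_num
  have habs : ∀ t : ℝ, 0 < s * t → |t| = s * t := by
    intro t ht; rw [← abs_of_pos ht, abs_mul, hs1, one_mul]
  have hmid : ∀ x, 0 < s * x → 0 < s * (ξ - x) → 0 < ε * (2 * x - ξ) →
      0 < s * (x * |x| ^ α + (ξ - x) * |ξ - x| ^ α - 2 * (ξ / 2 * |ξ / 2| ^ α)) ∧
      4 * (|x| * |ξ - x|) ^ (α / 2) *
        (s * (x * |x| ^ α + (ξ - x) * |ξ - x| ^ α - 2 * (ξ / 2 * |ξ / 2| ^ α))) ≤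
      (|x| + |ξ - x|) * (s * ((α + 1) * (|x| ^ α - |ξ - x| ^ α))) ^ 2 := by
    intro x h1 h2 h3
    obtain ⟨h4, h5⟩ := mul_rpow_midpoint_bounds (x := |x|) (y := |ξ - x|)
      (by linarith : 1 ≤ α) (by rwa [habs x h1]) (by rwa [habs _ h2]) (by
        rw [habs x h1, habs _ h2]
        intro h
        have : 2 * x - ξ = 0 := by linear_combination s * h - (2 * x - ξ) * hss
        rw [this, mul_zero] at h3
        exact h3.false)
    have e : |ξ / 2| = (|x| + |ξ - x|) / 2 := by
      rw [habs x h1, habs _ h2, habs (ξ / 2) (by linarith)]; ring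
    have e2 : |x| * |x| ^ α + |ξ - x| * |ξ - x| ^ α -
        2 * ((|x| + |ξ - x|) / 2 * ((|x| + |ξ - x|) / 2) ^ α) =
        s * (x * |x| ^ α + (ξ - x) * |ξ - x| ^ α - 2 * (ξ / 2 * |ξ / 2| ^ α)) := by
      rw [← e]
      generalize |x| ^ α = a, |ξ - x| ^ α = c, |ξ / 2| ^ α = d
      rw [habs x h1, habs _ h2, habs (ξ / 2) (by linarith)]; ring
    rw [e2] at h4 h5
    refine ⟨h4, h5.trans (le_of_eq ?_)⟩
    rw [mul_pow s, sq s, hss, one_mul]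
  have coeff : ∀ x, 0 < s * x → 0 < s * (ξ - x) →
      s * ((|x| + |ξ - x|) / (|x| * |ξ - x|)) = ξ / (x * (ξ - x)) := by
    intro x h1 h2
    have hx : x ≠ 0 := by rintro rfl; simp at h1
    have hy : ξ - x ≠ 0 := by intro h; rw [h] at h2; simp at h2
    have hs0 : s ≠ 0 := by rintro rfl; simp at hss
    rw [habs x h1, habs _ h2]
    field_simp
    ring
  have key := setLIntegral_mul_lintegral_le
    (S := {x | 0 < s * x ∧ 0 < s * (ξ - x) ∧ 0 < ε * (2 * x - ξ)}) (R := Set.univ)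
    (A := fun x => √((|x| + |ξ - x|) / (|x| * |ξ - x|)))
    (m := fun x => μ * x / ξ)
    (κ := fun x => s * (x * |x| ^ α + (ξ - x) * |ξ - x| ^ α - 2 * (ξ / 2 * |ξ / 2| ^ α)))
    (κ' := fun x => s * ((α + 1) * (|x| ^ α - |ξ - x| ^ α)))
    (w := fun x => (|x| ^ (α / 8 - 1 / 4) * |ξ - x| ^ (α / 8 - 1 / 4)) ^ 2)
    (E := fun x y => τ + phi α x y + phi α (ξ - x) (μ - y))
    (c := τ + μ ^ 2 / ξ + 2 * (ξ / 2 * |ξ / 2| ^ α)) (e₁ := s) (e₂ := s) (K := 1) (M := 1) hG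
    ?_ one_pos zero_le_one ?_ ?_ ?_ ?_ ?_ ?_ ?_
  · simpa only [Set.indicator_univ] using key
  · refine ⟨fun a ⟨ha1, ha2, ha3⟩ b ⟨hb1, hb2, hb3⟩ c ⟨hc1, hc2⟩ => ?_⟩
    rcases hs with rfl | rfl <;> rcases hε with rfl | rfl <;>
      exact ⟨by linarith, by linarith, by linarith⟩
  · intro x ⟨h1, h2, h3⟩
    rw [← habs x h1] at h1
    rw [← habs _ h2] at h2
    positivity
  · intro x ⟨h1, h2, h3⟩
    exact (hmid x h1 h2 h3).1
  · intro x _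
    have h1 := hasDerivAt_mul_abs_rpow (by linarith : 2 < α) x
    have h2 := (hasDerivAt_mul_abs_rpow (by linarith : 2 < α) (ξ - x)).comp x
      ((hasDerivAt_id x).const_sub ξ)
    exact (((h1.add h2).sub_const _).const_mul s).congr_deriv (by ring)
  · intro x ⟨h1, h2, h3⟩ h0
    obtain ⟨h4, h5⟩ := hmid x h1 h2 h3
    rw [h0] at h5
    rw [← habs x h1] at h1
    rw [← habs _ h2] at h2
    have : 0 < (|x| * |ξ - x|) ^ (α / 2) := by positivity
    have := mul_pos this h4
    linarith
  · intro x ⟨h1, h2, h3⟩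
    obtain ⟨h4, h5⟩ := hmid x h1 h2 h3
    rw [← habs x h1] at h1
    rw [← habs _ h2] at h2
    have e : ((|x| ^ (α / 8 - 1 / 4) * |ξ - x| ^ (α / 8 - 1 / 4)) ^ 2) ^ 2 =
        (|x| * |ξ - x|) ^ (α / 2) / (|x| * |ξ - x|) := by
      rw [← Real.mul_rpow h1.le h2.le, ← pow_mul, ← Real.rpow_natCast,
        ← Real.rpow_mul (by positivity), ← Real.rpow_sub_one (by positivity)]
      congr 1; push_cast; ring
    rw [e, Real.sq_sqrt (by positivity), one_pow, one_mul]
    have hxy : 0 < |x| * |ξ - x| := by positivity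
    refine le_trans (le_of_eq ?_) ((div_le_div_of_nonneg_right h5 hxy.le).trans (le_of_eq ?_)) <;>
      ring
  · intro x ⟨h1, h2, h3⟩ y
    have hx : x ≠ 0 := by rintro rfl; simp at h1
    have hy : ξ - x ≠ 0 := by intro h; rw [h] at h2; simp at h2
    have hξ : ξ ≠ 0 := by rintro rfl; linarith
    have h4 := phi_add_phi (α := α) μ y hξ hx hy
    have h5 := coeff x h1 h2
    simp only [mul_pow]
    rw [Real.sq_sqrt (by positivity)]
    linear_combination h4 - (y - μ * x / ξ) ^ 2 * h5 -
      (x * |x| ^ α + (ξ - x) * |ξ - x| ^ α - 2 * (ξ / 2 * |ξ / 2| ^ α)) * hss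
  · intro x ⟨h1, h2, h3⟩ y _
    have h4 := (hmid x h1 h2 h3).1
    rw [← mul_add, abs_mul, hs1, one_mul, one_mul]
    exact le_abs_self _

/-- The fibre integral in the region where `ξ₁` and `ξ₂` have the same sign. -/
theorem setLIntegral_same_sign_le {α : ℝ} (hα : 4 ≤ α) (ξ μ τ : ℝ) {G : ℝ → ℝ≥0∞}
    (hG : Measurable G) {s : ℝ} (hs : s = 1 ∨ s = -1) :
    ∫⁻ x in {x | 0 < s * x ∧ 0 < s * (ξ - x)},
      ENNReal.ofReal ((|x| ^ (α / 8 - 1 / 4) * |ξ - x| ^ (α / 8 - 1 / 4)) ^ 2) *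
        ∫⁻ y, G (τ + phi α x y + phi α (ξ - x) (μ - y)) ≤
      2 * (ENNReal.ofReal 1 * (ENNReal.ofReal (Real.pi * 1) * ∫⁻ t, G t)) := by
  have hsub : {x : ℝ | 0 < s * x ∧ 0 < s * (ξ - x)} ⊆
      ({x | 0 < s * x ∧ 0 < s * (ξ - x) ∧ 0 < 1 * (2 * x - ξ)} ∪
        {x | 0 < s * x ∧ 0 < s * (ξ - x) ∧ 0 < -1 * (2 * x - ξ)}) ∪ {ξ / 2} := by
    rintro x ⟨h1, h2⟩
    rcases lt_trichotomy (2 * x) ξ with h | h | h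
    · exact Or.inl (Or.inr ⟨h1, h2, by linarith⟩)
    · exact Or.inr (by rw [Set.mem_singleton_iff]; linarith)
    · exact Or.inl (Or.inl ⟨h1, h2, by linarith⟩)
  refine (lintegral_mono_set hsub).trans ((lintegral_union_le _ _ _).trans ?_)
  rw [setLIntegral_measure_zero {ξ / 2} _ (by simp), add_zero]
  refine (lintegral_union_le _ _ _).trans ?_
  rw [two_mul]
  exact add_le_add (setLIntegral_same_sign_half_le hα ξ μ τ hG hs (Or.inl rfl))
    (setLIntegral_same_sign_half_le hα ξ μ τ hG hs (Or.inr rfl))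

end Fibre

section Kernel

theorem measurableSet_ne_zero {P : Type*} [MeasurableSpace P] {f : P → ℝ} (hf : Measurable f) :
    MeasurableSet {a | f a ≠ 0} := hf (measurableSet_singleton 0).compl

@[fun_prop]
theorem measurable_phi (α : ℝ) : Measurable fun z : ℝ × ℝ => phi α z.1 z.2 := by
  unfold phi; fun_prop

@[fun_prop]
theorem measurable_sigma (α : ℝ) : Measurable (sigma α) := by
  unfold sigma phi; fun_prop

@[fun_prop]
theorem measurable_res (α : ℝ) : Measurable fun z : ℝ × ℝ => res α z.1 z.2 := by
  unfold res; fun_prop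

theorem phi_neg (α ξ μ : ℝ) : phi α (-ξ) (-μ) = -phi α ξ μ := by
  unfold phi; rw [abs_neg, div_neg]; ring

theorem sigma_neg (α : ℝ) (p : ℝ × ℝ × ℝ) : sigma α (-p) = -sigma α p := by
  simp only [sigma, Prod.fst_neg, Prod.snd_neg, phi_neg]; ring

/-- Integrating out `τ₁` reduces a fibre integral of a squared kernel to two variables. -/
theorem lintegral_indicator_bracketWeight_le (α : ℝ) {b : ℝ} (hb : 0 ≤ b) {S : Set ℝ}
    (hS : MeasurableSet S) {R : Set (ℝ × ℝ)} (hR : MeasurableSet R) {w : ℝ → ℝ≥0∞}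
    (hw : Measurable w) (p : ℝ × ℝ × ℝ) {B : ℝ≥0∞}
    (hB : ∫⁻ x in S, w x * ∫⁻ y, R.indicator (fun z => bracketWeight b
      (p.2.2 + phi α z.1 z.2 + phi α (p.1 - z.1) (p.2.1 - z.2))) (x, y) ≤ B) :
    ∫⁻ r, {r : ℝ × ℝ × ℝ | r.1 ∈ S ∧ (r.1, r.2.1) ∈ R}.indicator (fun r =>
      w r.1 * (bracketWeight b (sigma α r) * bracketWeight b (sigma α (p - r)))) r ≤
      ENNReal.ofReal (2 ^ b) * (2 * ∫⁻ e, bracketWeight b e) * B := by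
  have hF : Measurable ({r : ℝ × ℝ × ℝ | r.1 ∈ S ∧ (r.1, r.2.1) ∈ R}.indicator (fun r =>
      w r.1 * (bracketWeight b (sigma α r) * bracketWeight b (sigma α (p - r))))) := by
    refine Measurable.indicator (by fun_prop) ?_
    exact (measurable_fst hS).inter
      ((by fun_prop : Measurable fun r : ℝ × ℝ × ℝ => (r.1, r.2.1)) hR)
  have hQ : Measurable (R.indicator (fun z => bracketWeight b
      (p.2.2 + phi α z.1 z.2 + phi α (p.1 - z.1) (p.2.1 - z.2)))) := by
    refine Measurable.indicator ?_ hR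
    have : Measurable fun z : ℝ × ℝ => phi α (p.1 - z.1) (p.2.1 - z.2) :=
      (measurable_phi α).comp (by fun_prop : Measurable fun z : ℝ × ℝ => (p.1 - z.1, p.2.1 - z.2))
    fun_prop
  set J := ENNReal.ofReal (2 ^ b) * (2 * ∫⁻ e, bracketWeight b e) with hJ
  set F := {r : ℝ × ℝ × ℝ | r.1 ∈ S ∧ (r.1, r.2.1) ∈ R}.indicator (fun r =>
      w r.1 * (bracketWeight b (sigma α r) * bracketWeight b (sigma α (p - r)))) with hFd
  set Q := R.indicator (fun z => bracketWeight b
      (p.2.2 + phi α z.1 z.2 + phi α (p.1 - z.1) (p.2.1 - z.2))) with hQd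
  have hQ' : ∀ x, Measurable fun y => Q (x, y) := fun x => hQ.comp measurable_prodMk_left
  have fibre : ∀ x ∈ S, ∀ y, ∫⁻ t, F (x, y, t) ≤ J * (w x * Q (x, y)) := by
    intro x hx y
    by_cases hy : (x, y) ∈ R
    · rw [hQd, Set.indicator_of_mem hy]
      calc ∫⁻ t, F (x, y, t) = ∫⁻ t, w x * (bracketWeight b (t + phi α x y) *
            bracketWeight b (p.2.2 + phi α (p.1 - x) (p.2.1 - y) - t)) := by
            refine lintegral_congr fun t => ?_
            rw [hFd, Set.indicator_of_mem (by exact ⟨hx, hy⟩),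
              show sigma α (x, y, t) = t + phi α x y from rfl,
              show sigma α (p - (x, y, t)) = p.2.2 + phi α (p.1 - x) (p.2.1 - y) - t by
                simp only [sigma, Prod.fst_sub, Prod.snd_sub]; ring]
        _ ≤ w x * (J * bracketWeight b (phi α x y + (p.2.2 + phi α (p.1 - x) (p.2.1 - y)))) := by
            rw [lintegral_const_mul _ (by fun_prop)]
            gcongr
            exact lintegral_bracketWeight_mul_le hb _ _
        _ = _ := by
            rw [← add_assoc, add_comm (phi α x y)]; ring
    · have : ∀ t, F (x, y, t) = 0 := fun t => Set.indicator_of_notMem (fun h => hy h.2) _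
      simp [this]
  rw [Measure.volume_eq_prod, lintegral_prod _ hF.aemeasurable]
  calc _ ≤ ∫⁻ x, S.indicator (fun x => J * (w x * ∫⁻ y, Q (x, y))) x := by
        refine lintegral_mono fun x => ?_
        by_cases hx : x ∈ S
        · have hFx : Measurable fun z : ℝ × ℝ => F (x, z) := hF.comp measurable_prodMk_left
          rw [Set.indicator_of_mem hx, Measure.volume_eq_prod, lintegral_prod _ hFx.aemeasurable,
            ← lintegral_const_mul _ (hQ' x), ← lintegral_const_mul _ ((hQ' x).const_mul _)]
          exact lintegral_mono (fibre x hx)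
        · have : ∀ z, F (x, z) = 0 := fun z => Set.indicator_of_notMem (fun h => hx h.1) _
          simp [this]
    _ = J * ∫⁻ x in S, w x * ∫⁻ y, Q (x, y) := by
        rw [lintegral_indicator hS]
        exact lintegral_const_mul _ (hw.mul hQ.lintegral_prod_right')
    _ ≤ _ := by gcongr

/-- The region where `ξ₁` is the low frequency and the resonance hypothesis holds. -/
def lowHighRegion (α : ℝ) : Set ((ℝ × ℝ × ℝ) × (ℝ × ℝ × ℝ)) :=
  {q | q.1.1 ≠ 0 ∧ q.1.1 + q.2.1 ≠ 0 ∧ 2 * |q.1.1| ≤ |q.2.1| ∧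
    |res α (q.1.1 + q.2.1) q.1.1| / α ≤
      |sigma α (q.1 + q.2) - sigma α q.1 - sigma α q.2|}

/-- The weight of the trilinear form, restricted to `lowHighRegion`. -/
noncomputable def lowHighKernel (α b : ℝ) : (ℝ × ℝ × ℝ) × (ℝ × ℝ × ℝ) → ℝ≥0∞ :=
  (lowHighRegion α).indicator fun q =>
    ENNReal.ofReal (|q.1.1| ^ (-(1 : ℝ) / 2) * |q.2.1| ^ (α / 4)) *
      (bracketWeight b (sigma α q.1) * bracketWeight b (sigma α q.2))

/-- One factor of the kernel for comparable frequencies, restricted to frequencies of sign `s`. -/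
noncomputable def signWeight (α b s : ℝ) : ℝ × ℝ × ℝ → ℝ≥0∞ :=
  {p : ℝ × ℝ × ℝ | 0 < s * p.1}.indicator fun p =>
    ENNReal.ofReal (|p.1| ^ (α / 8 - 1 / 4)) * bracketWeight b (sigma α p)

@[fun_prop]
theorem measurable_lowHighKernel (α b : ℝ) : Measurable (lowHighKernel α b) := by
  refine Measurable.indicator (by fun_prop) ?_
  have h1 : Measurable fun q : (ℝ × ℝ × ℝ) × (ℝ × ℝ × ℝ) => res α (q.1.1 + q.2.1) q.1.1 :=
    (measurable_res α).comp (by fun_prop : Measurable fun q : (ℝ × ℝ × ℝ) × (ℝ × ℝ × ℝ) =>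
      (q.1.1 + q.2.1, q.1.1))
  rw [lowHighRegion, Set.ofPred_and, Set.ofPred_and, Set.ofPred_and]
  exact (measurableSet_ne_zero (by fun_prop)).inter ((measurableSet_ne_zero (by fun_prop)).inter
    ((measurableSet_le (by fun_prop) (by fun_prop)).inter
      (measurableSet_le (by fun_prop) (by fun_prop))))

@[fun_prop]
theorem measurable_signWeight (α b s : ℝ) : Measurable (signWeight α b s) :=
  Measurable.indicator (by fun_prop) (measurableSet_lt (by fun_prop) (by fun_prop))

theorem signWeight_neg (α b s : ℝ) (p : ℝ × ℝ × ℝ) :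
    signWeight α b s (-p) = signWeight α b (-s) p := by
  simp only [signWeight, Set.indicator, Set.mem_ofPred_eq, Prod.fst_neg, abs_neg, sigma_neg,
    bracketWeight_neg, mul_neg, neg_mul]

theorem lintegral_lowHighKernel_sq_le {α b : ℝ} (hα : 4 ≤ α) (hb : 1 / 2 < b) :
    ∃ B : ℝ≥0∞, B ≠ ∞ ∧ ∀ p, ∫⁻ r, lowHighKernel α b (r, p - r) ^ 2 ≤ B := by
  have hJ : ∫⁻ e, bracketWeight (2 * b) e ≠ ∞ :=
    (lintegral_bracketWeight_lt_top (by linarith)).ne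
  refine ⟨ENNReal.ofReal (2 ^ (2 * b)) * (2 * ∫⁻ e, bracketWeight (2 * b) e) *
    (2 * (ENNReal.ofReal √(8 * (α + 1) * 2 ^ α) *
      (ENNReal.ofReal (Real.pi * (2 * α + 1)) * ∫⁻ t, bracketWeight (2 * b) t))),
    by finiteness, fun p => ?_⟩
  by_cases hp : p.1 = 0
  · have : ∀ r, lowHighKernel α b (r, p - r) = 0 := fun r =>
      Set.indicator_of_notMem (fun h => h.2.1 (by simpa using hp)) _
    simp [this]
  have h := lintegral_indicator_bracketWeight_le α (by linarith : 0 ≤ 2 * b)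
    (S := {x | x ≠ 0 ∧ 2 * |x| ≤ |p.1 - x|})
    (R := {z : ℝ × ℝ | |res α p.1 z.1| / α ≤
            |phi α p.1 p.2.1 - phi α z.1 z.2 - phi α (p.1 - z.1) (p.2.1 - z.2)|})
    (w := fun x => ENNReal.ofReal ((|x| ^ (-(1 : ℝ) / 2) * |p.1 - x| ^ (α / 4)) ^ 2))
    ?_ ?_ (by fun_prop) p
    (setLIntegral_resonant_le hα hp p.2.1 p.2.2 (measurable_bracketWeight (2 * b)))
  · refine (lintegral_mono fun r => ?_).trans h
    by_cases hr : (r, p - r) ∈ lowHighRegion α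
    · rw [lowHighKernel, Set.indicator_of_mem hr, Set.indicator_of_mem]
      · rw [mul_pow, mul_pow, bracketWeight_sq, bracketWeight_sq,
          ← ENNReal.ofReal_pow (by positivity)]
        rfl
      · obtain ⟨h1, -, h3, h4⟩ := hr
        refine ⟨⟨h1, h3⟩, ?_⟩
        simp only [add_sub_cancel, sigma, Prod.fst_sub, Prod.snd_sub] at h4
        refine h4.trans (le_of_eq ?_)
        congr 1; ring
    · rw [lowHighKernel, Set.indicator_of_notMem hr]
      simp
  · rw [Set.ofPred_and]
    exact (measurableSet_ne_zero (by fun_prop)).inter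
      (measurableSet_le (by fun_prop) (by fun_prop))
  · have h1 : Measurable fun z : ℝ × ℝ => phi α (p.1 - z.1) (p.2.1 - z.2) :=
      (measurable_phi α).comp (by fun_prop : Measurable fun z : ℝ × ℝ => (p.1 - z.1, p.2.1 - z.2))
    have h2 : Measurable fun z : ℝ × ℝ => res α p.1 z.1 :=
      (measurable_res α).comp (by fun_prop : Measurable fun z : ℝ × ℝ => (p.1, z.1))
    exact measurableSet_le (by fun_prop) (by fun_prop)

theorem lintegral_signWeight_sq_le {α b s : ℝ} (hα : 4 ≤ α) (hb : 1 / 2 < b)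
    (hs : s = 1 ∨ s = -1) :
    ∃ B : ℝ≥0∞, B ≠ ∞ ∧
      ∀ p, ∫⁻ r, (signWeight α b s r * signWeight α b s (p - r)) ^ 2 ≤ B := by
  have hJ : ∫⁻ e, bracketWeight (2 * b) e ≠ ∞ :=
    (lintegral_bracketWeight_lt_top (by linarith)).ne
  refine ⟨ENNReal.ofReal (2 ^ (2 * b)) * (2 * ∫⁻ e, bracketWeight (2 * b) e) *
    (2 * (ENNReal.ofReal 1 * (ENNReal.ofReal (Real.pi * 1) * ∫⁻ t, bracketWeight (2 * b) t))),
    by finiteness, fun p => ?_⟩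
  have h := lintegral_indicator_bracketWeight_le α (by linarith : 0 ≤ 2 * b)
    (S := {x | 0 < s * x ∧ 0 < s * (p.1 - x)}) (R := Set.univ)
    (w := fun x => ENNReal.ofReal
      ((|x| ^ (α / 8 - 1 / 4) * |p.1 - x| ^ (α / 8 - 1 / 4)) ^ 2))
    (by
      rw [Set.ofPred_and]
      exact (measurableSet_lt (by fun_prop) (by fun_prop)).inter
        (measurableSet_lt (by fun_prop) (by fun_prop))) .univ (by fun_prop) p
    (by simpa only [Set.indicator_univ] using
      setLIntegral_same_sign_le hα p.1 p.2.1 p.2.2 (measurable_bracketWeight (2 * b)) hs)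
  refine (lintegral_mono fun r => ?_).trans h
  by_cases hr : 0 < s * r.1 ∧ 0 < s * (p.1 - r.1)
  · rw [signWeight, Set.indicator_of_mem (by exact hr.1), Set.indicator_of_mem (by exact hr.2),
      Set.indicator_of_mem (by exact ⟨hr, trivial⟩), ← bracketWeight_sq, ← bracketWeight_sq,
      ENNReal.ofReal_pow (by positivity), ENNReal.ofReal_mul (by positivity), Prod.fst_sub]
    refine le_of_eq ?_
    ring
  · have : signWeight α b s r * signWeight α b s (p - r) = 0 := by
      rw [not_and_or] at hr
      rcases hr with hr | hr
      · rw [signWeight, Set.indicator_of_notMem (by exact hr), zero_mul]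
      · rw [signWeight, Set.indicator_of_notMem (a := p - r) (by exact hr), mul_zero]
    simp [this]

end Kernel

section Trilinear

instance : (volume : Measure (ℝ × ℝ)).IsAddHaarMeasure :=
  inferInstanceAs ((volume : Measure ℝ).prod (volume : Measure ℝ)).IsAddHaarMeasure

instance : (volume : Measure (ℝ × ℝ × ℝ)).IsAddHaarMeasure :=
  inferInstanceAs ((volume : Measure ℝ).prod (volume : Measure (ℝ × ℝ))).IsAddHaarMeasure

/-- The trilinear form with kernel `k` is bounded on `L² × L² × L²`. -/
def TrilinearBounded (k : (ℝ × ℝ × ℝ) × (ℝ × ℝ × ℝ) → ℝ≥0∞) : Prop :=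
  ∃ C : ℝ≥0∞, C ≠ ∞ ∧ ∀ f g h : ℝ × ℝ × ℝ → ℝ≥0∞, Measurable f → Measurable g → Measurable h →
    ∫⁻ r, ∫⁻ s, k (r, s) * (f (r + s) * g r * h s) ≤
      C * ((∫⁻ p, f p ^ 2) ^ (1 / 2 : ℝ) * (∫⁻ p, g p ^ 2) ^ (1 / 2 : ℝ) *
        (∫⁻ p, h p ^ 2) ^ (1 / 2 : ℝ))

variable {k k' : (ℝ × ℝ × ℝ) × (ℝ × ℝ × ℝ) → ℝ≥0∞}

theorem TrilinearBounded.mono (hk : TrilinearBounded k) (h : ∀ q, k' q ≤ k q) :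
    TrilinearBounded k' := by
  obtain ⟨C, hC, hk⟩ := hk
  refine ⟨C, hC, fun f g h' hf hg hh => le_trans ?_ (hk f g h' hf hg hh)⟩
  gcongr
  exact h _

theorem TrilinearBounded.add (hk : TrilinearBounded k) (hk' : TrilinearBounded k')
    (hm : Measurable k) : TrilinearBounded (fun q => k q + k' q) := by
  obtain ⟨C, hC, hk⟩ := hk
  obtain ⟨C', hC', hk'⟩ := hk'
  refine ⟨C + C', by finiteness, fun f g h hf hg hh => ?_⟩
  have h1 : ∀ r, Measurable fun s => k (r, s) * (f (r + s) * g r * h s) := by fun_prop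
  have h2 : Measurable fun r => ∫⁻ s, k (r, s) * (f (r + s) * g r * h s) :=
    Measurable.lintegral_prod_right' (f := fun q : (ℝ × ℝ × ℝ) × (ℝ × ℝ × ℝ) =>
      k q * (f (q.1 + q.2) * g q.1 * h q.2)) (by fun_prop)
  calc _ = (∫⁻ r, ∫⁻ s, k (r, s) * (f (r + s) * g r * h s)) +
        ∫⁻ r, ∫⁻ s, k' (r, s) * (f (r + s) * g r * h s) := by
        rw [← lintegral_add_left h2]
        refine lintegral_congr fun r => ?_
        rw [← lintegral_add_left (h1 r)]
        simp only [add_mul]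
    _ ≤ _ := by
        rw [add_mul]
        exact add_le_add (hk f g h hf hg hh) (hk' f g h hf hg hh)

theorem TrilinearBounded.const_mul (hk : TrilinearBounded k) {c : ℝ≥0∞} (hc : c ≠ ∞) :
    TrilinearBounded (fun q => c * k q) := by
  obtain ⟨C, hC, hk⟩ := hk
  refine ⟨c * C, by finiteness, fun f g h hf hg hh => ?_⟩
  simp only [mul_assoc c]
  simp_rw [lintegral_const_mul' c _ hc]
  gcongr
  exact hk f g h hf hg hh

/-- Duality: a bilinear `L²` bound gives a trilinear bound. -/
theorem TrilinearBounded.of_lintegral_sq_le (hk : Measurable k) {B : ℝ≥0∞} (hB : B ≠ ∞)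
    (h : ∀ g h : ℝ × ℝ × ℝ → ℝ≥0∞, Measurable g → Measurable h →
      ∫⁻ p, (∫⁻ r, k (r, p - r) * (g r * h (p - r))) ^ 2 ≤
        B * ((∫⁻ p, g p ^ 2) * ∫⁻ p, h p ^ 2)) :
    TrilinearBounded k := by
  refine ⟨B ^ (1 / 2 : ℝ), by finiteness, fun f g h' hf hg hh => ?_⟩
  have hT : Measurable fun p => ∫⁻ r, k (r, p - r) * (g r * h' (p - r)) :=
    Measurable.lintegral_prod_right' (f := fun q : (ℝ × ℝ × ℝ) × (ℝ × ℝ × ℝ) =>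
      k (q.2, q.1 - q.2) * (g q.2 * h' (q.1 - q.2))) (by fun_prop)
  refine le_trans (le_of_eq ?_) (lintegral_mul_le_of_lintegral_sq_le hf hT (h g h' hg hh))
  calc _ = ∫⁻ r, ∫⁻ p, k (r, p - r) * (f p * g r * h' (p - r)) := by
        refine lintegral_congr fun r => ?_
        rw [← lintegral_sub_right_eq_self _ r]
        simp only [add_sub_cancel]
    _ = ∫⁻ p, ∫⁻ r, k (r, p - r) * (f p * g r * h' (p - r)) := by
        refine lintegral_lintegral_swap (Measurable.aemeasurable ?_)
        unfold Function.uncurry; fun_prop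
    _ = _ := by
        refine lintegral_congr fun p => ?_
        rw [← lintegral_const_mul _ (by fun_prop)]
        refine lintegral_congr fun r => ?_
        ring

theorem trilinearBounded_lowHighKernel {α b : ℝ} (hα : 4 ≤ α) (hb : 1 / 2 < b) :
    TrilinearBounded (lowHighKernel α b) := by
  obtain ⟨B, hB, h⟩ := lintegral_lowHighKernel_sq_le hα hb
  exact .of_lintegral_sq_le (measurable_lowHighKernel α b) hB fun g h' hg hh =>
    lintegral_sq_bilinear_le (k := fun r s => lowHighKernel α b (r, s))
      (measurable_lowHighKernel α b) h hg hh

theorem trilinearBounded_signWeight {α b s s' : ℝ} (hα : 4 ≤ α) (hb : 1 / 2 < b)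
    (hs : s = 1 ∨ s = -1) (hs' : s' = 1 ∨ s' = -1) :
    TrilinearBounded (fun q => signWeight α b s q.1 * signWeight α b s' q.2) := by
  obtain ⟨B, hB, h⟩ := lintegral_signWeight_sq_le hα hb hs
  have same : ∀ g h : ℝ × ℝ × ℝ → ℝ≥0∞, Measurable g → Measurable h →
      ∫⁻ p, (∫⁻ r, signWeight α b s r * signWeight α b s (p - r) * (g r * h (p - r))) ^ 2 ≤
        B * ((∫⁻ p, g p ^ 2) * ∫⁻ p, h p ^ 2) := fun g h' hg hh =>
    lintegral_sq_bilinear_le (k := fun r t => signWeight α b s r * signWeight α b s t)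
      (by unfold Function.uncurry; fun_prop) h hg hh
  refine .of_lintegral_sq_le (by fun_prop) hB fun g h' hg hh => ?_
  have hcases : s' = s ∨ s' = -s := by
    rcases hs with rfl | rfl <;> rcases hs' with rfl | rfl <;> norm_num
  rcases hcases with rfl | rfl
  · exact same g h' hg hh
  · calc _ = ∫⁻ p, (∫⁻ r, (signWeight α b s r * g r) *
          (fun t => signWeight α b (-s) t * h' t) (p - r)) ^ 2 := by
          simp only [mul_mul_mul_comm]
      _ = ∫⁻ p, (∫⁻ r, (signWeight α b s r * g r) *
          (fun t => signWeight α b (-s) t * h' t) (r - p)) ^ 2 :=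
          lintegral_sq_convolution_neg (g := fun r => signWeight α b s r * g r)
            (h := fun t => signWeight α b (-s) t * h' t) (by fun_prop) (by fun_prop)
      _ = ∫⁻ p, (∫⁻ r, signWeight α b s r * signWeight α b s (p - r) *
          (g r * (fun t => h' (-t)) (p - r))) ^ 2 := by
          simp only [neg_sub, ← signWeight_neg, mul_mul_mul_comm]
      _ ≤ B * ((∫⁻ p, g p ^ 2) * ∫⁻ p, h' (-p) ^ 2) := same _ _ hg (by fun_prop)
      _ = _ := by rw [lintegral_neg_eq_self fun p => h' p ^ 2]

/-- The region of integration, in terms of `((ξ₁, μ₁, τ₁), (ξ₂, μ₂, τ₂))`. -/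
def resonantRegion (α : ℝ) : Set ((ℝ × ℝ × ℝ) × (ℝ × ℝ × ℝ)) :=
  {q | q.1.1 ≠ 0 ∧ q.2.1 ≠ 0 ∧ q.1.1 + q.2.1 ≠ 0 ∧
    |res α (q.1.1 + q.2.1) q.1.1| / α ≤
      |sigma α (q.1 + q.2) - sigma α q.1 - sigma α q.2|}

/-- The weight `|ξ₁|^{-1/2} |ξ₂|^{α/4} ⟨σ₁⟩^{-b} ⟨σ₂⟩^{-b}` on `resonantRegion`. -/
noncomputable def resonantKernel (α b : ℝ) : (ℝ × ℝ × ℝ) × (ℝ × ℝ × ℝ) → ℝ≥0∞ :=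
  (resonantRegion α).indicator fun q =>
    ENNReal.ofReal (wgt α b q.1.1 q.2.1 (sigma α q.1) (sigma α q.2))

@[fun_prop]
theorem measurable_resonantKernel (α b : ℝ) : Measurable (resonantKernel α b) := by
  refine Measurable.indicator (by unfold wgt; fun_prop) ?_
  have h1 : Measurable fun q : (ℝ × ℝ × ℝ) × (ℝ × ℝ × ℝ) => res α (q.1.1 + q.2.1) q.1.1 :=
    (measurable_res α).comp (by fun_prop : Measurable fun q : (ℝ × ℝ × ℝ) × (ℝ × ℝ × ℝ) =>
      (q.1.1 + q.2.1, q.1.1))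
  rw [resonantRegion, Set.ofPred_and, Set.ofPred_and, Set.ofPred_and]
  exact (measurableSet_ne_zero (by fun_prop)).inter ((measurableSet_ne_zero (by fun_prop)).inter
    ((measurableSet_ne_zero (by fun_prop)).inter (measurableSet_le (by fun_prop) (by fun_prop))))

theorem ofReal_wgt (α b x y s t : ℝ) : ENNReal.ofReal (wgt α b x y s t) =
    ENNReal.ofReal (|x| ^ (-(1 : ℝ) / 2) * |y| ^ (α / 4)) *
      (bracketWeight b s * bracketWeight b t) := by
  rw [wgt, bracketWeight, bracketWeight, ← ENNReal.ofReal_mul (by positivity),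
    ← ENNReal.ofReal_mul (by positivity), mul_assoc, mul_assoc]

/-- When the frequencies are not in the low-high regime the weight is dominated by a product. -/
theorem rpow_mul_rpow_le {α x y : ℝ} (hα : 4 ≤ α) (hx : 0 < x) (hy : 0 < y) (hxy : y ≤ 2 * x) :
    x ^ (-(1 : ℝ) / 2) * y ^ (α / 4) ≤
      2 ^ (α / 8 + 1 / 4) * (x ^ (α / 8 - 1 / 4) * y ^ (α / 8 - 1 / 4)) := by
  have e1 : y ^ (α / 4) = y ^ (α / 8 + 1 / 4) * y ^ (α / 8 - 1 / 4) := by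
    rw [← Real.rpow_add hy]; congr 1; ring
  have e2 : x ^ (α / 8 - 1 / 4) = x ^ (-(1 : ℝ) / 2) * x ^ (α / 8 + 1 / 4) := by
    rw [← Real.rpow_add hx]; congr 1; ring
  have h := Real.rpow_le_rpow hy.le hxy (by linarith : 0 ≤ α / 8 + 1 / 4)
  rw [Real.mul_rpow (by norm_num) hx.le] at h
  rw [e1, e2]
  calc _ ≤ x ^ (-(1 : ℝ) / 2) * (2 ^ (α / 8 + 1 / 4) * x ^ (α / 8 + 1 / 4) *
        y ^ (α / 8 - 1 / 4)) := by gcongr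
    _ = _ := by ring

theorem ofReal_mul_bracketWeight_le_signWeight (α b : ℝ) {p : ℝ × ℝ × ℝ} (hp : p.1 ≠ 0) :
    ENNReal.ofReal (|p.1| ^ (α / 8 - 1 / 4)) * bracketWeight b (sigma α p) ≤
      signWeight α b 1 p + signWeight α b (-1) p := by
  rcases lt_or_gt_of_ne hp with h | h
  · refine le_trans (le_of_eq ?_) le_add_self
    rw [signWeight, Set.indicator_of_mem]
    show 0 < -1 * p.1
    linarith
  · refine le_trans (le_of_eq ?_) le_self_add
    rw [signWeight, Set.indicator_of_mem]
    show 0 < 1 * p.1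
    linarith

theorem resonantKernel_le {α b : ℝ} (hα : 4 ≤ α) (q : (ℝ × ℝ × ℝ) × (ℝ × ℝ × ℝ)) :
    resonantKernel α b q ≤ lowHighKernel α b q + ENNReal.ofReal (2 ^ (α / 8 + 1 / 4)) *
      ((signWeight α b 1 q.1 * signWeight α b 1 q.2 +
        signWeight α b 1 q.1 * signWeight α b (-1) q.2) +
      (signWeight α b (-1) q.1 * signWeight α b 1 q.2 +
        signWeight α b (-1) q.1 * signWeight α b (-1) q.2)) := by
  by_cases hq : q ∈ resonantRegion α
  swap
  · rw [resonantKernel, Set.indicator_of_notMem hq]; exact zero_le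
  rw [resonantKernel, Set.indicator_of_mem hq, ofReal_wgt]
  obtain ⟨h1, h2, h3, h4⟩ := hq
  by_cases hlow : 2 * |q.1.1| ≤ |q.2.1|
  · refine le_trans (le_of_eq ?_) le_self_add
    rw [lowHighKernel, Set.indicator_of_mem (by exact ⟨h1, h3, hlow, h4⟩)]
  · refine le_trans ?_ le_add_self
    rw [← mul_add, ← mul_add, ← add_mul]
    calc _ ≤ ENNReal.ofReal (2 ^ (α / 8 + 1 / 4) *
          (|q.1.1| ^ (α / 8 - 1 / 4) * |q.2.1| ^ (α / 8 - 1 / 4))) *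
          (bracketWeight b (sigma α q.1) * bracketWeight b (sigma α q.2)) := by
          gcongr ENNReal.ofReal ?_ * _
          exact rpow_mul_rpow_le hα (abs_pos.2 h1) (abs_pos.2 h2) (not_le.1 hlow).le
      _ = ENNReal.ofReal (2 ^ (α / 8 + 1 / 4)) *
          ((ENNReal.ofReal (|q.1.1| ^ (α / 8 - 1 / 4)) * bracketWeight b (sigma α q.1)) *
          (ENNReal.ofReal (|q.2.1| ^ (α / 8 - 1 / 4)) * bracketWeight b (sigma α q.2))) := by
          rw [ENNReal.ofReal_mul (by positivity), ENNReal.ofReal_mul (by positivity)]; ring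
      _ ≤ _ := by
          gcongr <;> exact ofReal_mul_bracketWeight_le_signWeight α b (by assumption)

theorem trilinearBounded_resonantKernel {α b : ℝ} (hα : 4 ≤ α) (hb : 1 / 2 < b) :
    TrilinearBounded (resonantKernel α b) := by
  have h : ∀ s s' : ℝ, (s = 1 ∨ s = -1) → (s' = 1 ∨ s' = -1) →
      TrilinearBounded (fun q => signWeight α b s q.1 * signWeight α b s' q.2) :=
    fun s s' hs hs' => trilinearBounded_signWeight hα hb hs hs'
  refine ((trilinearBounded_lowHighKernel hα hb).add (.const_mul (.add
    ((h 1 1 (by simp) (by simp)).add (h 1 (-1) (by simp) (by simp)) (by fun_prop))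
    ((h (-1) 1 (by simp) (by simp)).add (h (-1) (-1) (by simp) (by simp)) (by fun_prop))
    (by fun_prop)) ENNReal.ofReal_ne_top) (by fun_prop)).mono (resonantKernel_le hα)

end Trilinear

section Reduction

theorem sub3_eq_sub (q p : ℝ × ℝ × ℝ) : sub3 q p = q - p := rfl

theorem eLpNorm_two_eq_lintegral_sq {P : Type*} [MeasurableSpace P] {μ : Measure P} {f : P → ℝ}
    (hf : ∀ p, 0 ≤ f p) :
    eLpNorm f 2 μ = (∫⁻ p, ENNReal.ofReal (f p) ^ 2 ∂μ) ^ (1 / 2 : ℝ) := by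
  rw [eLpNorm_eq_lintegral_rpow_enorm_toReal (by norm_num) (by norm_num)]
  simp only [ENNReal.toReal_ofNat, ENNReal.rpow_ofNat]
  congr 1
  refine lintegral_congr fun p => ?_
  rw [Real.enorm_of_nonneg (hf p)]

theorem setLIntegral_ofReal_mul_le {D : Set ((ℝ × ℝ × ℝ) × (ℝ × ℝ × ℝ))}
    {W : (ℝ × ℝ × ℝ) × (ℝ × ℝ × ℝ) → ℝ} {K : (ℝ × ℝ × ℝ) × (ℝ × ℝ × ℝ) → ℝ≥0∞}
    (hK : Measurable K) (hW : ∀ q ∈ D, ENNReal.ofReal (W q) ≤ K q) {f f₁ f₂ : ℝ × ℝ × ℝ → ℝ}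
    (hf : Measurable f) (hf₁ : Measurable f₁) (hf₂ : Measurable f₂) (hf0 : ∀ p, 0 ≤ f p)
    (hf₁0 : ∀ p, 0 ≤ f₁ p) (hf₂0 : ∀ p, 0 ≤ f₂ p) :
    ∫⁻ q in D, ENNReal.ofReal (W q * (f q.2 * f₁ q.1 * f₂ (sub3 q.2 q.1))) ≤
      ∫⁻ q, K q * (ENNReal.ofReal (f q.2) * ENNReal.ofReal (f₁ q.1) *
        ENNReal.ofReal (f₂ (q.2 - q.1))) := by
  refine le_trans (setLIntegral_mono (by fun_prop) fun q hq => ?_) (setLIntegral_le_lintegral D _)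
  have h1 := mul_nonneg (hf0 q.2) (hf₁0 q.1)
  rw [ENNReal.ofReal_mul' (mul_nonneg h1 (hf₂0 _)), ENNReal.ofReal_mul h1,
    ENNReal.ofReal_mul (hf0 _)]
  exact mul_le_mul' (hW q hq) le_rfl

theorem ofReal_wgt_le_resonantKernel {α b x y s t : ℝ} {q : (ℝ × ℝ × ℝ) × (ℝ × ℝ × ℝ)}
    (hq : q ∈ resonantRegion α) (hx : |x| = |q.1.1|) (hy : |y| = |q.2.1|)
    (hs : |s| = |sigma α q.1|) (ht : |t| = |sigma α q.2|) :
    ENNReal.ofReal (wgt α b x y s t) ≤ resonantKernel α b q := by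
  rw [resonantKernel, Set.indicator_of_mem hq, wgt, wgt, hx, hy, hs, ht]

theorem abs_res_neg_left (α ξ x : ℝ) : |res α (ξ - x) (-x)| = |res α ξ x| := by
  rw [res, res, show ξ - x - -x = ξ by ring, abs_neg, ← abs_neg]
  congr 1; ring

theorem abs_res_swap (α ξ x : ℝ) : |res α x ξ| = |res α ξ x| := by
  rw [res, res, abs_sub_comm x ξ, ← abs_neg]
  congr 1; ring

theorem abs_res_sub (α ξ x : ℝ) : |res α (ξ - x) ξ| = |res α ξ x| := by
  rw [res, res, show ξ - x - ξ = -x by ring, abs_neg, ← abs_neg]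
  congr 1; ring

end Reduction

/-- **Paper's Lemma 2.5, inequalities (2.017)–(2.020).**
For `α ≥ 4` and `b > 1/2` there is `C > 0` such that for all nonnegative
`f, f₁, f₂ ∈ L²(ℝ³)` and each of the four weights
(i) `|ξ₁|^{-1/2}|ξ₂|^{α/4}⟨σ₁⟩^{-b}⟨σ₂⟩^{-b}`, (ii) `|ξ₁|^{-1/2}|ξ|^{α/4}⟨σ₁⟩^{-b}⟨σ⟩^{-b}`,
(iii) `|ξ|^{-1/2}|ξ₂|^{α/4}⟨σ⟩^{-b}⟨σ₂⟩^{-b}`, (iv) `|ξ|^{-1/2}|ξ₁|^{α/4}⟨σ⟩^{-b}⟨σ₁⟩^{-b}`,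
the integral over the region `{ξ ξ₁ ξ₂ ≠ 0, |σ − σ₁ − σ₂| ≥ |Δ|/α}` of
`W · f(ξ,μ,τ) f₁(ξ₁,μ₁,τ₁) f₂(ξ₂,μ₂,τ₂)` is at most `C ‖f‖_{L²} ‖f₁‖_{L²} ‖f₂‖_{L²}`. -/
theorem stmt10 (α b : ℝ) (hα : 4 ≤ α) (hb : 1 / 2 < b) :
    ∃ C : ℝ, 0 < C ∧ ∀ f f₁ f₂ : ℝ × ℝ × ℝ → ℝ,
      Measurable f → Measurable f₁ → Measurable f₂ →
      (∀ p, 0 ≤ f p) → (∀ p, 0 ≤ f₁ p) → (∀ p, 0 ≤ f₂ p) →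
      ((∫⁻ q : (ℝ × ℝ × ℝ) × (ℝ × ℝ × ℝ) in
          {q : (ℝ × ℝ × ℝ) × (ℝ × ℝ × ℝ) |
            q.1.1 ≠ 0 ∧ q.2.1 ≠ 0 ∧ q.2.1 - q.1.1 ≠ 0 ∧
            |res α q.2.1 q.1.1| / α ≤
              |sigma α q.2 - sigma α q.1 - sigma α (sub3 q.2 q.1)|},
          ENNReal.ofReal
            (wgt α b q.1.1 (q.2.1 - q.1.1) (sigma α q.1) (sigma α (sub3 q.2 q.1)) *
              (f q.2 * f₁ q.1 * f₂ (sub3 q.2 q.1)))) ≤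
        ENNReal.ofReal C * eLpNorm f 2 volume * eLpNorm f₁ 2 volume *
          eLpNorm f₂ 2 volume) ∧
      ((∫⁻ q : (ℝ × ℝ × ℝ) × (ℝ × ℝ × ℝ) in
          {q : (ℝ × ℝ × ℝ) × (ℝ × ℝ × ℝ) |
            q.1.1 ≠ 0 ∧ q.2.1 ≠ 0 ∧ q.2.1 - q.1.1 ≠ 0 ∧
            |res α q.2.1 q.1.1| / α ≤
              |sigma α q.2 - sigma α q.1 - sigma α (sub3 q.2 q.1)|},
          ENNReal.ofReal
            (wgt α b q.1.1 q.2.1 (sigma α q.1) (sigma α q.2) *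
              (f q.2 * f₁ q.1 * f₂ (sub3 q.2 q.1)))) ≤
        ENNReal.ofReal C * eLpNorm f 2 volume * eLpNorm f₁ 2 volume *
          eLpNorm f₂ 2 volume) ∧
      ((∫⁻ q : (ℝ × ℝ × ℝ) × (ℝ × ℝ × ℝ) in
          {q : (ℝ × ℝ × ℝ) × (ℝ × ℝ × ℝ) |
            q.1.1 ≠ 0 ∧ q.2.1 ≠ 0 ∧ q.2.1 - q.1.1 ≠ 0 ∧
            |res α q.2.1 q.1.1| / α ≤
              |sigma α q.2 - sigma α q.1 - sigma α (sub3 q.2 q.1)|},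
          ENNReal.ofReal
            (wgt α b q.2.1 (q.2.1 - q.1.1) (sigma α q.2) (sigma α (sub3 q.2 q.1)) *
              (f q.2 * f₁ q.1 * f₂ (sub3 q.2 q.1)))) ≤
        ENNReal.ofReal C * eLpNorm f 2 volume * eLpNorm f₁ 2 volume *
          eLpNorm f₂ 2 volume) ∧
      ((∫⁻ q : (ℝ × ℝ × ℝ) × (ℝ × ℝ × ℝ) in
          {q : (ℝ × ℝ × ℝ) × (ℝ × ℝ × ℝ) |
            q.1.1 ≠ 0 ∧ q.2.1 ≠ 0 ∧ q.2.1 - q.1.1 ≠ 0 ∧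
            |res α q.2.1 q.1.1| / α ≤
              |sigma α q.2 - sigma α q.1 - sigma α (sub3 q.2 q.1)|},
          ENNReal.ofReal
            (wgt α b q.2.1 q.1.1 (sigma α q.2) (sigma α q.1) *
              (f q.2 * f₁ q.1 * f₂ (sub3 q.2 q.1)))) ≤
        ENNReal.ofReal C * eLpNorm f 2 volume * eLpNorm f₁ 2 volume *
          eLpNorm f₂ 2 volume) := by
  obtain ⟨C, hC, h⟩ := trilinearBounded_resonantKernel hα hb
  refine ⟨C.toReal + 1, by positivity, fun f f₁ f₂ hf hf₁ hf₂ hf0 hf₁0 hf₂0 => ?_⟩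
  have hCle : C ≤ ENNReal.ofReal (C.toReal + 1) := by
    rw [ENNReal.le_ofReal_iff_toReal_le hC (by positivity)]
    linarith
  rw [eLpNorm_two_eq_lintegral_sq hf0, eLpNorm_two_eq_lintegral_sq hf₁0,
    eLpNorm_two_eq_lintegral_sq hf₂0]
  set F : ℝ × ℝ × ℝ → ℝ≥0∞ := fun p => ENNReal.ofReal (f p) with hF
  set F₁ : ℝ × ℝ × ℝ → ℝ≥0∞ := fun p => ENNReal.ofReal (f₁ p) with hF₁
  set F₂ : ℝ × ℝ × ℝ → ℝ≥0∞ := fun p => ENNReal.ofReal (f₂ p) with hF₂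
  have mF : Measurable F := by fun_prop
  have mF₁ : Measurable F₁ := by fun_prop
  have mF₂ : Measurable F₂ := by fun_prop
  have nF₁ := lintegral_neg_eq_self (μ := volume) fun p => F₁ p ^ 2
  have nF₂ := lintegral_neg_eq_self (μ := volume) fun p => F₂ p ^ 2
  have finish : ∀ I : ℝ≥0∞, I ≤ C * ((∫⁻ p, F p ^ 2) ^ (1 / 2 : ℝ) *
      (∫⁻ p, F₁ p ^ 2) ^ (1 / 2 : ℝ) * (∫⁻ p, F₂ p ^ 2) ^ (1 / 2 : ℝ)) →
      I ≤ ENNReal.ofReal (C.toReal + 1) * (∫⁻ p, F p ^ 2) ^ (1 / 2 : ℝ) *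
        (∫⁻ p, F₁ p ^ 2) ^ (1 / 2 : ℝ) * (∫⁻ p, F₂ p ^ 2) ^ (1 / 2 : ℝ) := by
    intro I hI
    rw [mul_assoc, mul_assoc, ← mul_assoc (_ ^ _)]
    exact hI.trans (mul_le_mul' hCle le_rfl)
  refine ⟨finish _ ?_, finish _ ?_, finish _ ?_, finish _ ?_⟩
  · refine (setLIntegral_ofReal_mul_le (K := fun q => resonantKernel α b (q.1, q.2 - q.1))
      (by fun_prop) ?_ hf hf₁ hf₂ hf0 hf₁0 hf₂0).trans ?_
    · rintro q ⟨h1, h2, h3, h4⟩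
      refine ofReal_wgt_le_resonantKernel ⟨h1, h3, ?_, ?_⟩ rfl rfl rfl rfl
      · simpa using h2
      · simpa [sub3_eq_sub] using h4
    · rw [Measure.volume_eq_prod, lintegral_prod _ (by fun_prop)]
      refine le_trans (le_of_eq (lintegral_congr fun r => ?_)) (h F F₁ F₂ mF mF₁ mF₂)
      rw [← lintegral_add_left_eq_self _ r]
      simp only [add_sub_cancel_left, hF, hF₁, hF₂]
  · refine (setLIntegral_ofReal_mul_le (K := fun q => resonantKernel α b (-q.1, q.2))
      (by fun_prop) ?_ hf hf₁ hf₂ hf0 hf₁0 hf₂0).trans ?_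
    · rintro q ⟨h1, h2, h3, h4⟩
      refine ofReal_wgt_le_resonantKernel ⟨neg_ne_zero.2 h1, h2, ?_, ?_⟩ (abs_neg _).symm rfl
        (by rw [sigma_neg, abs_neg]) rfl
      · simpa [neg_add_eq_sub] using h3
      · simp only [Prod.fst_neg, abs_res_neg_left, sigma_neg, neg_add_eq_sub]
        refine h4.trans (le_of_eq ?_)
        rw [← abs_neg, sub3_eq_sub]; congr 1; ring
    · rw [Measure.volume_eq_prod, lintegral_prod _ (by fun_prop), ← lintegral_neg_eq_self]
      refine (le_trans (le_of_eq (lintegral_congr fun r => lintegral_congr fun s => ?_))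
        (h F₂ (fun p => F₁ (-p)) F mF₂ (by fun_prop) mF)).trans (le_of_eq ?_)
      · simp only [hF, hF₁, hF₂, neg_neg, sub_neg_eq_add, add_comm s r]; ring
      · rw [nF₁]; ring
  · refine (setLIntegral_ofReal_mul_le (K := fun q => resonantKernel α b (q.2, q.1 - q.2))
      (by fun_prop) ?_ hf hf₁ hf₂ hf0 hf₁0 hf₂0).trans ?_
    · rintro q ⟨h1, h2, h3, h4⟩
      refine ofReal_wgt_le_resonantKernel ⟨h2, ?_, ?_, ?_⟩ rfl (abs_sub_comm _ _) rfl
        (by rw [← neg_sub q.2, sigma_neg, abs_neg, sub3_eq_sub])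
      · exact sub_ne_zero.2 (sub_ne_zero.1 h3).symm
      · simpa using h1
      · simp only [Prod.fst_sub, add_sub_cancel]
        rw [abs_res_swap]
        refine h4.trans (le_of_eq ?_)
        rw [← neg_sub q.2 q.1, sigma_neg, ← abs_neg, sub3_eq_sub]; congr 1; ring
    · rw [Measure.volume_eq_prod, lintegral_prod_symm _ (by fun_prop)]
      refine (le_trans (le_of_eq (lintegral_congr fun r => ?_))
        (h F₁ F (fun p => F₂ (-p)) mF₁ mF (by fun_prop))).trans (le_of_eq ?_)
      · rw [← lintegral_add_left_eq_self _ r]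
        refine lintegral_congr fun s => ?_
        simp only [hF, hF₁, hF₂, add_sub_cancel_left, sub_add_cancel_left]; ring
      · rw [nF₂]; ring
  · refine (setLIntegral_ofReal_mul_le (K := fun q => resonantKernel α b (q.2, -q.1))
      (by fun_prop) ?_ hf hf₁ hf₂ hf0 hf₁0 hf₂0).trans ?_
    · rintro q ⟨h1, h2, h3, h4⟩
      refine ofReal_wgt_le_resonantKernel ⟨h2, neg_ne_zero.2 h1, ?_, ?_⟩ rfl (abs_neg _).symm rfl
        (by rw [sigma_neg, abs_neg])
      · simpa [← sub_eq_add_neg] using h3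
      · simp only [Prod.fst_neg, ← sub_eq_add_neg, abs_res_sub, sigma_neg]
        refine h4.trans (le_of_eq ?_)
        rw [← abs_neg, sub3_eq_sub]; congr 1; ring
    · rw [Measure.volume_eq_prod, lintegral_prod_symm _ (by fun_prop)]
      refine (le_trans (le_of_eq (lintegral_congr fun r => ?_))
        (h F₂ F (fun p => F₁ (-p)) mF₂ mF (by fun_prop))).trans (le_of_eq ?_)
      · rw [← lintegral_neg_eq_self]
        refine lintegral_congr fun s => ?_
        simp only [hF, hF₁, hF₂, neg_neg, sub_neg_eq_add]; ring
      · rw [nF₁]; ring
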